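/- Let p ∈ ℂ[z] be a nonconstant polynomial and let B_p = ℂ[x,y,z]/(xy − p(z)). The following are equivalent: (1) there exists a real structure on B_p, i.e. a ring automorphism σ of B_p with σ ∘ σ = id and σ(c·f) = c̄·σ(f) for all c ∈ ℂ and f ∈ B_p; (2) there exist a, λ ∈ ℂ* and b ∈ ℂ such that λ·p(az + b) has all coefficients in ℝ; (3) there exists q ∈ ℝ[z] such that B_p and B_q = ℂ[x,y,z]/(xy − q(z)) are isomorphic as ℂ-algebras. -/

import Mathlib

open MvPolynomial

/-- The coordinate ring `ℂ[x,y,z]/(xy - p(z))` of the surface `D_p`. -/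
noncomputable abbrev BpAlg (p : Polynomial ℂ) :=
  MvPolynomial (Fin 3) ℂ ⧸
    Ideal.span {(X 0 * X 1 : MvPolynomial (Fin 3) ℂ) - Polynomial.aeval (X 2) p}

namespace Dan

abbrev S := LaurentPolynomial (Polynomial ℂ)

noncomputable def mo (n : ℤ) (h : Polynomial ℂ) : S := AddMonoidAlgebra.single n h

lemma mo_coeff (n : ℤ) (h : Polynomial ℂ) (k : ℤ) :
    (mo n h).coeff k = if n = k then h else 0 := by
  rw [mo, AddMonoidAlgebra.coeff_single, Finsupp.single_apply]

lemma mo_add (n : ℤ) (h k : Polynomial ℂ) : mo n (h + k) = mo n h + mo n k := by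
  simp [mo]

lemma mo_zero (n : ℤ) : mo n 0 = 0 := by simp [mo]

lemma mo_mul (n m : ℤ) (h k : Polynomial ℂ) : mo n h * mo m k = mo (n + m) (h * k) := by
  rw [mo, mo, mo, AddMonoidAlgebra.single_mul_single]

lemma mo_one : mo 0 1 = 1 := rfl

lemma mo_pow (n : ℤ) (h : Polynomial ℂ) (k : ℕ) : mo n h ^ k = mo (k * n) (h ^ k) := by
  induction k with
  | zero => simp [mo_one]
  | succ k ih => rw [pow_succ, ih, mo_mul, pow_succ]; congr 1; push_cast; ring

lemma S_ext {f g : S} (h : ∀ n, f.coeff n = g.coeff n) : f = g := LaurentPolynomial.ext h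

@[elab_as_elim]
lemma S_ind {P : S → Prop} (f : S) (add : ∀ f g, P f → P g → P (f + g))
    (hm : ∀ n h, P (mo n h)) : P f := by
  refine LaurentPolynomial.induction_on' f add ?_
  intro n a
  rw [← LaurentPolynomial.single_eq_C_mul_T]
  exact hm n a

lemma coeff_add' (f g : S) (n : ℤ) : (f + g).coeff n = f.coeff n + g.coeff n := rfl
lemma coeff_sub' (f g : S) (n : ℤ) : (f - g).coeff n = f.coeff n - g.coeff n := by
  have := coeff_add' (f - g) g n
  rw [sub_add_cancel] at this
  rw [this]; ring

lemma smul_eq (c : ℂ) (f : S) : c • f = mo 0 (Polynomial.C c) * f := by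
  rw [Algebra.smul_def]; rfl

lemma coeff_mo_mul (n : ℤ) (h : Polynomial ℂ) (f : S) (k : ℤ) :
    (mo n h * f).coeff k = h * f.coeff (k - n) := by
  rw [mo, AddMonoidAlgebra.coeff_single_mul_apply]; congr 2; ring

lemma algMap_eq (c : ℂ) : algebraMap ℂ S c = mo 0 (Polynomial.C c) := rfl

/-- derivative in `z` -/
noncomputable def dz : S →+ S where
  toFun f := .ofCoeff (f.coeff.mapRange Polynomial.derivative (by simp))
  map_zero' := by apply S_ext; simp
  map_add' f g := by apply S_ext; simp

lemma dz_coeff (f : S) (n : ℤ) : (dz f).coeff n = Polynomial.derivative (f.coeff n) := by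
  simp [dz]

lemma dz_mo (n : ℤ) (h : Polynomial ℂ) : dz (mo n h) = mo n (Polynomial.derivative h) := by
  apply S_ext; intro k; rw [dz_coeff, mo_coeff, mo_coeff]; split_ifs <;> simp

/-- Euler derivation `x d/dx` -/
noncomputable def th (f : S) : S := .ofCoeff
  (Finsupp.onFinset f.coeff.support (fun n => (n : Polynomial ℂ) * f.coeff n) (by
    intro a ha; simp only [Finsupp.mem_support_iff]; intro h; exact ha (by rw [h, mul_zero])))

lemma th_coeff (f : S) (n : ℤ) : (th f).coeff n = (n : Polynomial ℂ) * f.coeff n := by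
  simp [th]

lemma th_add (f g : S) : th (f + g) = th f + th g := by
  apply S_ext; intro n; simp only [coeff_add', th_coeff]; ring

lemma th_mo (n : ℤ) (h : Polynomial ℂ) : th (mo n h) = mo n ((n : Polynomial ℂ) * h) := by
  apply S_ext; intro k; rw [th_coeff, mo_coeff, mo_coeff]; split_ifs with h
  · rw [h]
  · simp

lemma dz_mul (f g : S) : dz (f * g) = dz f * g + f * dz g := by
  refine S_ind f ?_ ?_
  · intro a b ha hb; rw [add_mul, map_add, ha, hb, map_add]; ring
  intro n h
  refine S_ind g ?_ ?_
  · intro a b ha hb; rw [mul_add, map_add, ha, hb, map_add]; ring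
  intro m k
  rw [mo_mul, dz_mo, dz_mo, dz_mo, mo_mul, mo_mul, ← mo_add, Polynomial.derivative_mul]

lemma th_mul (f g : S) : th (f * g) = th f * g + f * th g := by
  refine S_ind f ?_ ?_
  · intro a b ha hb; rw [add_mul, th_add, ha, hb, th_add]; ring
  intro n h
  refine S_ind g ?_ ?_
  · intro a b ha hb; rw [mul_add, th_add, ha, hb, th_add]; ring
  intro m k
  rw [mo_mul, th_mo, th_mo, th_mo, mo_mul, mo_mul, ← mo_add]; congr 1; push_cast; ring

/-- Poisson bracket -/
noncomputable def br (f g : S) : S := th f * dz g - dz f * th g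

lemma br_add_right (f g h : S) : br f (g + h) = br f g + br f h := by
  simp only [br, map_add, th_add]; ring
lemma br_mul_right (f g h : S) : br f (g * h) = br f g * h + g * br f h := by
  simp only [br, dz_mul, th_mul]; ring
lemma br_skew (f g : S) : br f g = - br g f := by simp only [br]; ring
lemma br_add_left (f g h : S) : br (f + g) h = br f h + br g h := by
  rw [br_skew, br_add_right, br_skew f, br_skew g]; ring
lemma br_mul_left (f g h : S) : br (f * g) h = br f h * g + f * br g h := by
  rw [br_skew, br_mul_right, br_skew f, br_skew g]; ring
lemma br_self (f : S) : br f f = 0 := by simp only [br]; ring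
lemma br_const_right (f : S) (c : ℂ) : br f (algebraMap ℂ S c) = 0 := by
  rw [algMap_eq, br, dz_mo, th_mo]; simp [mo_zero]
lemma br_const_left (f : S) (c : ℂ) : br (algebraMap ℂ S c) f = 0 := by
  rw [br_skew, br_const_right, neg_zero]

/-- x-degree at most `a` -/
def Le (a : ℤ) (f : S) : Prop := ∀ k, a < k → f.coeff k = 0

lemma Le.mul {a b : ℤ} {f g : S} (hf : Le a f) (hg : Le b g) :
    Le (a + b) (f * g) ∧ (f * g).coeff (a + b) = f.coeff a * g.coeff b := by
  constructor
  · intro k hk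
    rw [AddMonoidAlgebra.coeff_mul_apply_left]
    apply Finset.sum_eq_zero
    intro n _
    by_cases h : a < n
    · simp [hf n h]
    · show _ * g.coeff (-n + k) = 0
      rw [hg _ (by omega), mul_zero]
  · rw [AddMonoidAlgebra.coeff_mul_apply_left, Finsupp.sum, Finset.sum_eq_single a]
    · show _ * g.coeff (-a + (a + b)) = _
      congr 2; ring
    · intro n _ hn
      rcases lt_or_gt_of_ne hn with h | h
      · show _ * g.coeff (-n + (a + b)) = 0
        rw [hg _ (by omega), mul_zero]
      · simp [hf n h]
    · intro h; simp at h; simp [h]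

lemma Le.br {a b : ℤ} {f g : S} (hf : Le a f) (hg : Le b g) :
    Le (a + b) (br f g) ∧ (br f g).coeff (a + b) =
      (a : Polynomial ℂ) * f.coeff a * Polynomial.derivative (g.coeff b)
      - (b : Polynomial ℂ) * Polynomial.derivative (f.coeff a) * g.coeff b := by
  have h1 : Le a (th f) := fun k hk => by rw [th_coeff, hf k hk, mul_zero]
  have h2 : Le b (th g) := fun k hk => by rw [th_coeff, hg k hk, mul_zero]
  have h3 : Le a (dz f) := fun k hk => by rw [dz_coeff, hf k hk, Polynomial.derivative_zero]
  have h4 : Le b (dz g) := fun k hk => by rw [dz_coeff, hg k hk, Polynomial.derivative_zero]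
  constructor
  · intro k hk
    rw [Dan.br, coeff_sub', (h1.mul h4).1 k hk, (h3.mul h2).1 k hk, sub_zero]
  · rw [Dan.br, coeff_sub', (h1.mul h4).2, (h3.mul h2).2, th_coeff, th_coeff, dz_coeff, dz_coeff]
    ring

lemma exists_top {f : S} (hf : f ≠ 0) : ∃ a, Le a f ∧ f.coeff a ≠ 0 := by
  have hne : f.coeff.support.Nonempty := by
    rw [Finsupp.support_nonempty_iff]; intro h; exact hf (AddMonoidAlgebra.coeff_eq_zero.1 h)
  refine ⟨f.coeff.support.max' hne, ?_, ?_⟩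
  · intro k hk
    by_contra h
    have := f.coeff.support.le_max' k (Finsupp.mem_support_iff.2 h)
    omega
  · exact Finsupp.mem_support_iff.1 (Finset.max'_mem _ hne)

/-! weight substitution: `x ↦ x^N`, `z ↦ x^M z`. -/
noncomputable def zsub (M : ℤ) : Polynomial ℂ →+* S :=
  (Polynomial.aeval (mo M Polynomial.X) : Polynomial ℂ →ₐ[ℂ] S).toRingHom

lemma zsub_monomial (M : ℤ) (m : ℕ) (c : ℂ) :
    zsub M (Polynomial.monomial m c) = mo (m * M) (Polynomial.monomial m c) := by
  simp only [zsub, AlgHom.toRingHom_eq_coe, RingHom.coe_coe, Polynomial.aeval_monomial,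
    algMap_eq, mo_pow, mo_mul, zero_add, Polynomial.C_mul_X_pow_eq_monomial]

noncomputable def psi (N M : ℤ) : S →+* S :=
  LaurentPolynomial.eval₂ (zsub M) ⟨mo N 1, mo (-N) 1, by simp [mo_mul, mo_one], by simp [mo_mul, mo_one]⟩

lemma mo_zpow (N n : ℤ) (u : Sˣ) (hu : (u : S) = mo N 1) : ((u ^ n : Sˣ) : S) = mo (n * N) 1 := by
  have hi : ((u⁻¹ : Sˣ) : S) = mo (-N) 1 := by
    rw [← mul_one ((u⁻¹ : Sˣ) : S), Units.inv_mul_eq_iff_eq_mul, hu, mo_mul]; simp [mo_one]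
  obtain ⟨k, rfl | rfl⟩ := n.eq_nat_or_neg
  · rw [zpow_natCast, Units.val_pow_eq_pow_val, hu, mo_pow, one_pow]
  · rw [zpow_neg, zpow_natCast, ← inv_pow, Units.val_pow_eq_pow_val, hi, mo_pow, one_pow]; congr 1; ring

lemma psi_mo (N M n : ℤ) (h : Polynomial ℂ) : psi N M (mo n h) = zsub M h * mo (n * N) 1 := by
  have : mo n h = LaurentPolynomial.C h * LaurentPolynomial.T n := LaurentPolynomial.single_eq_C_mul_T h n
  rw [psi, this, LaurentPolynomial.eval₂_C_mul_T, mo_zpow N n _ rfl]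

lemma psi_mono (N M n : ℤ) (m : ℕ) (c : ℂ) :
    psi N M (mo n (Polynomial.monomial m c)) = mo (N * n + M * m) (Polynomial.monomial m c) := by
  rw [psi_mo, zsub_monomial, mo_mul, mul_one]; congr 1; ring

@[elab_as_elim]
lemma S_ind' {P : S → Prop} (f : S) (add : ∀ f g, P f → P g → P (f + g))
    (hm : ∀ n m c, P (mo n (Polynomial.monomial m c))) : P f := by
  refine S_ind f add ?_
  intro n h
  refine Polynomial.induction_on' (motive := fun h => P (mo n h)) h ?_ ?_
  · intro p q hp hq; rw [mo_add]; exact add _ _ hp hq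
  · intro m c; exact hm n m c

lemma psi_coeff (N M : ℤ) (hN : N ≠ 0) (f : S) (n : ℤ) (m : ℕ) :
    ((psi N M f).coeff (N * n + M * m)).coeff m = (f.coeff n).coeff m := by
  refine S_ind' f ?_ ?_
  · intro a b ha hb; simp only [map_add, coeff_add', Polynomial.coeff_add, ha, hb]
  · intro n' m' c
    rw [psi_mono, mo_coeff, mo_coeff]
    by_cases hm : m' = m
    · subst hm
      have : (N * n' + M * m' = N * n + M * m') ↔ n' = n := by simp [hN]
      simp only [this]
    · split_ifs <;> simp [Polynomial.coeff_monomial, hm]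

lemma psi_coeff_ne (N M : ℤ) (f : S) (W : ℤ) (m : ℕ)
    (h : ((psi N M f).coeff W).coeff m ≠ 0) : ∃ n, W = N * n + M * m := by
  by_contra hcon
  apply h
  refine S_ind' f ?_ ?_
  · intro a b ha hb; simp only [map_add, coeff_add', Polynomial.coeff_add, ha, hb, add_zero]
  · intro n' m' c
    rw [psi_mono, mo_coeff]
    split_ifs with h1
    · rw [Polynomial.coeff_monomial]; split_ifs with h2
      · subst h2; exact absurd ⟨n', h1.symm⟩ hcon
      · rfl
    · simp

lemma psi_dz (N M : ℤ) (f : S) : dz (psi N M f) = mo M 1 * psi N M (dz f) := by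
  refine S_ind' f ?_ ?_
  · intro a b ha hb; simp only [map_add, ha, hb]; ring
  intro n m c
  rw [psi_mono, dz_mo, dz_mo, Polynomial.derivative_monomial, psi_mono, mo_mul, one_mul]
  rcases m with _ | m
  · simp [mo_zero]
  · rw [Nat.add_sub_cancel]; congr 1; push_cast; ring

lemma psi_th (N M : ℤ) (f : S) : th (psi N M f) =
    (N : S) * psi N M (th f) + (M : S) * (mo M Polynomial.X * psi N M (dz f)) := by
  have hc : ∀ K : ℤ, (K : S) = mo 0 (K : Polynomial ℂ) := fun K => by
    rw [← Polynomial.C_eq_intCast, ← algMap_eq, map_intCast]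
  refine S_ind' f ?_ ?_
  · intro a b ha hb; simp only [map_add, th_add, ha, hb]; ring
  intro n m c
  have e1 : ∀ (K : ℤ) (m : ℕ) (c : ℂ), (K : Polynomial ℂ) * Polynomial.monomial m c = Polynomial.monomial m (K * c) := by
    intro K m c; rw [← Polynomial.C_eq_intCast, Polynomial.C_mul_monomial]
  rw [psi_mono, th_mo, dz_mo, th_mo, Polynomial.derivative_monomial, e1, e1, psi_mono, psi_mono, hc, hc,
    mo_mul, mo_mul, mo_mul, e1, zero_add, Polynomial.X_mul_monomial, e1]
  rcases m with _ | m
  · simp [mo_zero]; ring_nf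
  · have : M + (N * n + M * ((m + 1 - 1 : ℕ) : ℤ)) = N * n + M * ((m + 1 : ℕ) : ℤ) := by simp; ring
    rw [zero_add, this, ← mo_add]; congr 1; rw [Nat.add_sub_cancel, ← map_add]
    congr 1; push_cast; ring

lemma psi_br (N M : ℤ) (f g : S) : br (psi N M f) (psi N M g) = (N : S) * mo M 1 * psi N M (br f g) := by
  simp only [br, psi_dz, psi_th, map_sub, map_mul]; ring

lemma br_x (g : S) : br (mo 1 1) g = mo 1 1 * dz g := by
  rw [br, th_mo, dz_mo]; simp [mo_zero]

end Dan

namespace Dan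

lemma step (N M : ℤ) (hN : N ≠ 0) {a b : ℤ} {f g : S} (hf : Le a (psi N M f)) (hg : Le b (psi N M g)) :
    Le (a + b - M) (psi N M (br f g)) ∧ (psi N M (br f g)).coeff (a + b - M) =
      Polynomial.C ((N : ℂ)⁻¹) * ((a : Polynomial ℂ) * (psi N M f).coeff a * Polynomial.derivative ((psi N M g).coeff b)
      - (b : Polynomial ℂ) * Polynomial.derivative ((psi N M f).coeff a) * (psi N M g).coeff b) := by
  have hN' : (N : ℂ) ≠ 0 := by exact_mod_cast hN
  have hc : (N : S) = mo 0 (Polynomial.C (N : ℂ)) := by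
    rw [← algMap_eq, map_intCast]
  have key : psi N M (br f g) = mo (-M) (Polynomial.C ((N : ℂ)⁻¹)) * br (psi N M f) (psi N M g) := by
    rw [psi_br, hc, ← mul_assoc, ← mul_assoc, mo_mul, mo_mul, ← Polynomial.C_mul, inv_mul_cancel₀ hN']
    simp [mo_one]
  obtain ⟨h1, h2⟩ := hf.br hg
  constructor
  · intro k hk
    rw [key, coeff_mo_mul, h1 _ (by omega), mul_zero]
  · rw [key, coeff_mo_mul, ← h2]; congr 2; ring

lemma nil_ord (N M : ℤ) (hN : N ≠ 0) {a : ℤ} {f : S} (hf : Le a (psi N M f)) (c : ℂ) (m : ℕ)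
    (hm : 1 ≤ m) (R : Polynomial ℂ) (hP : (psi N M f).coeff a = (Polynomial.X - Polynomial.C c) ^ m * R)
    (hR : R.eval c ≠ 0) (n : ℕ) : ∀ (g : S) (b : ℤ) (ν : ℕ) (T : Polynomial ℂ), Le b (psi N M g) →
    (psi N M g).coeff b = (Polynomial.X - Polynomial.C c) ^ ν * T → T.eval c ≠ 0 →
    (br f)^[n] g = 0 → ∃ k : ℕ, a * ν - b * m = k * (a - m * M) := by
  have hN' : (N : ℂ) ≠ 0 := by exact_mod_cast hN
  induction n with
  | zero =>
    intro g b ν T _ hQ hT h0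
    exfalso
    simp only [Function.iterate_zero, id_eq] at h0
    rw [h0, map_zero] at hQ
    have : (Polynomial.X - Polynomial.C c) ^ ν * T = 0 := hQ.symm
    rcases mul_eq_zero.1 this with h | h
    · exact pow_ne_zero ν (Polynomial.X_sub_C_ne_zero c) h
    · rw [h] at hT; simp at hT
  | succ n ih =>
    intro g b ν T hb hQ hT h0
    by_cases hz : (a : ℤ) * ν - b * m = 0
    · exact ⟨0, by rw [hz]; simp⟩
    obtain ⟨s1, s2⟩ := step N M hN hf hb
    rw [Function.iterate_succ, Function.comp_apply] at h0
    have hz' : (a : ℂ) * ν - b * m ≠ 0 := by exact_mod_cast hz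
    obtain ⟨m', rfl⟩ : ∃ m', m = m' + 1 := ⟨m - 1, by omega⟩
    obtain ⟨k, hk⟩ := ih (br f g) (a + b - M) (m' + ν)
      (Polynomial.C ((N : ℂ)⁻¹) * ((Polynomial.C ((a : ℂ) * ν - b * (m' + 1 : ℕ))) * R * T
        + (Polynomial.X - Polynomial.C c) * ((a : Polynomial ℂ) * R * Polynomial.derivative T
          - (b : Polynomial ℂ) * Polynomial.derivative R * T))) s1 (by
        rw [s2, hP, hQ]
        simp only [Polynomial.derivative_mul, Polynomial.derivative_X_sub_C_pow, Nat.add_sub_cancel,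
          Polynomial.C_sub, Polynomial.C_mul, Polynomial.C_eq_intCast, Polynomial.C_eq_natCast]
        rcases ν with _ | ν
        · push_cast; ring
        · rw [Nat.add_sub_cancel]; push_cast; ring) (by
        simp only [Polynomial.eval_mul, Polynomial.eval_add, Polynomial.eval_sub, Polynomial.eval_C,
          Polynomial.eval_X, sub_self, zero_mul, add_zero]
        exact mul_ne_zero (inv_ne_zero hN') (mul_ne_zero (mul_ne_zero hz' hR) hT)) h0
    refine ⟨k + 1, ?_⟩
    push_cast at hk ⊢
    linear_combination hk

lemma nil_deg (N M : ℤ) (hN : N ≠ 0) {a : ℤ} {f : S} (hf : Le a (psi N M f)) (m : ℕ)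
    (hP0 : (psi N M f).coeff a ≠ 0) (hP : ((psi N M f).coeff a).natDegree = m)
    (n : ℕ) : ∀ (g : S) (b : ℤ) (ν : ℕ), Le b (psi N M g) →
    (psi N M g).coeff b ≠ 0 → ((psi N M g).coeff b).natDegree = ν →
    (br f)^[n] g = 0 → ∃ k : ℕ, a * ν - b * m = k * (a - m * M) := by
  have hN' : (N : ℂ) ≠ 0 := by exact_mod_cast hN
  induction n with
  | zero =>
    intro g b ν _ hQ _ h0
    exfalso
    simp only [Function.iterate_zero, id_eq] at h0
    rw [h0, map_zero] at hQ
    exact hQ rfl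
  | succ n ih =>
    intro g b ν hb hQ0 hQ h0
    by_cases hz : (a : ℤ) * ν - b * m = 0
    · exact ⟨0, by rw [hz]; simp⟩
    obtain ⟨s1, s2⟩ := step N M hN hf hb
    rw [Function.iterate_succ, Function.comp_apply] at h0
    have hz' : (a : ℂ) * ν - b * m ≠ 0 := by exact_mod_cast hz
    obtain ⟨μ, hμ⟩ : ∃ μ, m + ν = μ + 1 := ⟨m + ν - 1, by
      have : m + ν ≠ 0 := by
        intro h; apply hz
        have h1 : m = 0 := by omega
        have h2 : ν = 0 := by omega
        simp [h1, h2]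
      omega⟩
    set P := (psi N M f).coeff a with hPdef
    set Q := (psi N M g).coeff b with hQdef
    have c1 : (P * Polynomial.derivative Q).coeff μ = ν * (P.leadingCoeff * Q.leadingCoeff) ∧
        (P * Polynomial.derivative Q).natDegree ≤ μ := by
      rcases ν with _ | ν
      · rw [Polynomial.natDegree_eq_zero] at hQ
        obtain ⟨q, hq⟩ := hQ
        rw [← hq]; simp
      · have : m + ν = μ := by omega
        have h3 : (Polynomial.derivative Q).natDegree ≤ ν := by
          have := Polynomial.natDegree_derivative_le Q; omega
        constructor
        · rw [← this, Polynomial.coeff_mul_add_eq_of_natDegree_le hP.le h3, Polynomial.coeff_derivative,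
            Polynomial.leadingCoeff, Polynomial.leadingCoeff, hP, hQ]; push_cast; ring
        · exact Polynomial.natDegree_mul_le.trans (by omega)
    have c2 : (Polynomial.derivative P * Q).coeff μ = m * (P.leadingCoeff * Q.leadingCoeff) ∧
        (Polynomial.derivative P * Q).natDegree ≤ μ := by
      rcases m with _ | m
      · rw [Polynomial.natDegree_eq_zero] at hP
        obtain ⟨q, hq⟩ := hP
        rw [← hq]; simp
      · have : m + ν = μ := by omega
        have h3 : (Polynomial.derivative P).natDegree ≤ m := by
          have := Polynomial.natDegree_derivative_le P; omega
        constructor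
        · rw [← this, Polynomial.coeff_mul_add_eq_of_natDegree_le h3 hQ.le, Polynomial.coeff_derivative,
            Polynomial.leadingCoeff, Polynomial.leadingCoeff, hP, hQ]; push_cast; ring
        · exact Polynomial.natDegree_mul_le.trans (by omega)
    have e : (psi N M (br f g)).coeff (a + b - M) = Polynomial.C ((N : ℂ)⁻¹) *
        (Polynomial.C (a : ℂ) * (P * Polynomial.derivative Q) -
          Polynomial.C (b : ℂ) * (Polynomial.derivative P * Q)) := by
      rw [s2, Polynomial.C_eq_intCast, Polynomial.C_eq_intCast]; ring
    have hl : (N : ℂ)⁻¹ * (((a : ℂ) * ν - b * m) * (P.leadingCoeff * Q.leadingCoeff)) ≠ 0 :=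
      mul_ne_zero (inv_ne_zero hN') (mul_ne_zero hz' (mul_ne_zero
        (Polynomial.leadingCoeff_ne_zero.2 hP0) (Polynomial.leadingCoeff_ne_zero.2 hQ0)))
    have hc : ((psi N M (br f g)).coeff (a + b - M)).coeff μ ≠ 0 := by
      convert hl using 1
      rw [e, Polynomial.coeff_C_mul, Polynomial.coeff_sub, Polynomial.coeff_C_mul, Polynomial.coeff_C_mul,
        c1.1, c2.1]; ring
    have hd : ((psi N M (br f g)).coeff (a + b - M)).natDegree = μ := by
      apply le_antisymm
      · rw [e]
        refine (Polynomial.natDegree_C_mul_le _ _).trans ((Polynomial.natDegree_sub_le _ _).trans ?_)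
        exact max_le ((Polynomial.natDegree_C_mul_le _ _).trans c1.2)
          ((Polynomial.natDegree_C_mul_le _ _).trans c2.2)
      · exact Polynomial.le_natDegree_of_ne_zero hc
    obtain ⟨k, hk⟩ := ih (br f g) (a + b - M) μ s1 (by intro h; rw [h] at hc; simp at hc) hd h0
    refine ⟨k + 1, ?_⟩
    have hμ' : (μ : ℤ) = m + ν - 1 := by omega
    rw [hμ'] at hk
    push_cast at hk ⊢
    linear_combination hk

end Dan

namespace Dan

section
variable (p : Polynomial ℂ)

noncomputable def bx : BpAlg p := Ideal.Quotient.mk _ (X 0)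
noncomputable def by' : BpAlg p := Ideal.Quotient.mk _ (X 1)
noncomputable def bz : BpAlg p := Ideal.Quotient.mk _ (X 2)

lemma rel : bx p * by' p = Polynomial.aeval (bz p) p := by
  have h : Polynomial.aeval (bz p) p = Ideal.Quotient.mk
      (Ideal.span {(X 0 * X 1 : MvPolynomial (Fin 3) ℂ) - Polynomial.aeval (X 2) p}) (Polynomial.aeval (X 2) p) := by
    have := Polynomial.aeval_algHom_apply (Ideal.Quotient.mkₐ ℂ
      (Ideal.span {(X 0 * X 1 : MvPolynomial (Fin 3) ℂ) - Polynomial.aeval (X 2) p})) (X 2 : MvPolynomial (Fin 3) ℂ) p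
    exact this
  rw [h, bx, by', ← map_mul, Ideal.Quotient.eq]
  exact Ideal.subset_span rfl

lemma gen_ind {P : BpAlg p → Prop} (f : BpAlg p) (hc : ∀ c : ℂ, P (algebraMap ℂ _ c))
    (add : ∀ f g, P f → P g → P (f + g)) (hx : ∀ f, P f → P (f * bx p))
    (hy : ∀ f, P f → P (f * by' p)) (hz : ∀ f, P f → P (f * bz p)) : P f := by
  obtain ⟨F, rfl⟩ := Ideal.Quotient.mk_surjective f
  induction F using MvPolynomial.induction_on with
  | C a => exact hc a
  | add f g hf hg => rw [map_add]; exact add _ _ hf hg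
  | mul_X f i hf =>
    rw [map_mul]
    fin_cases i
    · exact hx _ hf
    · exact hy _ hf
    · exact hz _ hf

variable {p} in
noncomputable def blift {R : Type*} [CommRing R] [Algebra ℂ R] (a b c : R)
    (h : a * b = Polynomial.aeval c p) : BpAlg p →ₐ[ℂ] R :=
  Ideal.Quotient.liftₐ _ (MvPolynomial.aeval ![a, b, c]) (by
    intro F hF
    have hle : Ideal.span {(X 0 * X 1 : MvPolynomial (Fin 3) ℂ) - Polynomial.aeval (X 2) p} ≤
        RingHom.ker (MvPolynomial.aeval ![a, b, c] : MvPolynomial (Fin 3) ℂ →ₐ[ℂ] R) := by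
      rw [Ideal.span_le, Set.singleton_subset_iff]
      simp only [SetLike.mem_coe, RingHom.mem_ker, map_sub, map_mul, MvPolynomial.aeval_X,
        ← Polynomial.aeval_algHom_apply]
      simp [h]
    exact hle hF)

section
variable {p} {R : Type*} [CommRing R] [Algebra ℂ R] (a b c : R) (h : a * b = Polynomial.aeval c p)
@[simp] lemma blift_x : blift a b c h (bx p) = a := by
  show MvPolynomial.aeval ![a, b, c] (X 0) = a
  simp
@[simp] lemma blift_y : blift a b c h (by' p) = b := by
  show MvPolynomial.aeval ![a, b, c] (X 1) = b
  simp
@[simp] lemma blift_z : blift a b c h (bz p) = c := by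
  show MvPolynomial.aeval ![a, b, c] (X 2) = c
  simp
end

lemma bhom_ext {R : Type*} [CommRing R] [Algebra ℂ R] (f g : BpAlg p →ₐ[ℂ] R)
    (hx : f (bx p) = g (bx p)) (hy : f (by' p) = g (by' p)) (hz : f (bz p) = g (bz p)) (u : BpAlg p) :
    f u = g u := by
  refine gen_ind p (P := fun u => f u = g u) u ?_ ?_ ?_ ?_ ?_
  · intro c; simp
  · intro a b ha hb; simp [ha, hb]
  · intro a ha; simp [ha, hx]
  · intro a ha; simp [ha, hy]
  · intro a ha; simp [ha, hz]

lemma aeval_mo (h : Polynomial ℂ) : Polynomial.aeval (mo 0 Polynomial.X) h = mo 0 h := by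
  induction h using Polynomial.induction_on' with
  | add f g hf hg => rw [map_add, hf, hg, mo_add]
  | monomial n c =>
    rw [Polynomial.aeval_monomial, mo_pow, algMap_eq, mo_mul, Polynomial.C_mul_X_pow_eq_monomial]; simp

noncomputable def io : BpAlg p →ₐ[ℂ] S := blift (mo 1 1) (mo (-1) p) (mo 0 Polynomial.X) (by
  rw [aeval_mo, mo_mul]; simp)

@[simp] lemma io_x : io p (bx p) = mo 1 1 := blift_x ..
@[simp] lemma io_y : io p (by' p) = mo (-1) p := blift_y ..
@[simp] lemma io_z : io p (bz p) = mo 0 Polynomial.X := blift_z ..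
@[simp] lemma io_hz (h : Polynomial ℂ) : io p (Polynomial.aeval (bz p) h) = mo 0 h := by
  rw [← Polynomial.aeval_algHom_apply, io_z, aeval_mo]

lemma B_ind {P : BpAlg p → Prop} (f : BpAlg p) (add : ∀ f g, P f → P g → P (f + g))
    (hx : ∀ (n : ℕ) (h : Polynomial ℂ), P (bx p ^ n * Polynomial.aeval (bz p) h))
    (hy : ∀ (n : ℕ) (h : Polynomial ℂ), P (by' p ^ n * Polynomial.aeval (bz p) h)) : P f := by
  let T0 : Set (BpAlg p) := {u | ∃ (n : ℕ) (h : Polynomial ℂ), u = bx p ^ n * Polynomial.aeval (bz p) h ∨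
    u = by' p ^ n * Polynomial.aeval (bz p) h}
  have h0 : P 0 := by simpa using hx 0 0
  have hX : ∀ (n : ℕ) (h : Polynomial ℂ), bx p ^ n * Polynomial.aeval (bz p) h ∈ AddSubmonoid.closure T0 := fun n h =>
    AddSubmonoid.subset_closure ⟨n, h, Or.inl rfl⟩
  have hY : ∀ (n : ℕ) (h : Polynomial ℂ), by' p ^ n * Polynomial.aeval (bz p) h ∈ AddSubmonoid.closure T0 := fun n h =>
    AddSubmonoid.subset_closure ⟨n, h, Or.inr rfl⟩
  have clos : ∀ v : BpAlg p, (∀ u ∈ T0, u * v ∈ AddSubmonoid.closure T0) → ∀ u ∈ AddSubmonoid.closure T0,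
      u * v ∈ AddSubmonoid.closure T0 := by
    intro v hv u hu
    induction hu using AddSubmonoid.closure_induction with
    | mem u hu => exact hv u hu
    | zero => rw [zero_mul]; exact zero_mem _
    | add a b _ _ ha hb => rw [add_mul]; exact add_mem ha hb
  have all : f ∈ AddSubmonoid.closure T0 := by
    refine gen_ind p (P := fun f => f ∈ AddSubmonoid.closure T0) f ?_ ?_ ?_ ?_ ?_
    · intro c; have := hX 0 (Polynomial.C c); simpa using this
    · intro a b ha hb; exact add_mem ha hb
    · refine clos _ ?_
      rintro u ⟨n, h, rfl | rfl⟩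
      · have := hX (n + 1) h
        rwa [show bx p ^ (n + 1) * Polynomial.aeval (bz p) h = bx p ^ n * Polynomial.aeval (bz p) h * bx p by ring] at this
      · rcases n with _ | n
        · have := hX 1 h
          rwa [show bx p ^ 1 * Polynomial.aeval (bz p) h = by' p ^ 0 * Polynomial.aeval (bz p) h * bx p by ring] at this
        · have := hY n (p * h)
          rwa [map_mul, ← rel, show by' p ^ n * (bx p * by' p * Polynomial.aeval (bz p) h) = by' p ^ (n+1) * Polynomial.aeval (bz p) h * bx p by ring] at this
    · refine clos _ ?_
      rintro u ⟨n, h, rfl | rfl⟩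
      · rcases n with _ | n
        · have := hY 1 h
          rwa [show by' p ^ 1 * Polynomial.aeval (bz p) h = bx p ^ 0 * Polynomial.aeval (bz p) h * by' p by ring] at this
        · have := hX n (p * h)
          rwa [map_mul, ← rel, show bx p ^ n * (bx p * by' p * Polynomial.aeval (bz p) h) = bx p ^ (n+1) * Polynomial.aeval (bz p) h * by' p by ring] at this
      · have := hY (n + 1) h
        rwa [show by' p ^ (n + 1) * Polynomial.aeval (bz p) h = by' p ^ n * Polynomial.aeval (bz p) h * by' p by ring] at this
    · refine clos _ ?_
      rintro u ⟨n, h, rfl | rfl⟩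
      · have := hX n (h * Polynomial.X)
        rwa [map_mul, Polynomial.aeval_X, ← mul_assoc] at this
      · have := hY n (h * Polynomial.X)
        rwa [map_mul, Polynomial.aeval_X, ← mul_assoc] at this
  induction all using AddSubmonoid.closure_induction with
  | mem u hu =>
    obtain ⟨n, h, rfl | rfl⟩ := hu
    · exact hx n h
    · exact hy n h
  | zero => exact h0
  | add a b _ _ ha hb => exact add _ _ ha hb

lemma io_xn (n : ℕ) (h : Polynomial ℂ) : io p (bx p ^ n * Polynomial.aeval (bz p) h) = mo n h := by
  rw [map_mul, map_pow, io_x, io_hz, mo_pow, mo_mul]; simp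
lemma io_yn (n : ℕ) (h : Polynomial ℂ) : io p (by' p ^ n * Polynomial.aeval (bz p) h) = mo (-n) (p ^ n * h) := by
  rw [map_mul, map_pow, io_y, io_hz, mo_pow, mo_mul]; simp

lemma io_dvd (f : BpAlg p) (n : ℕ) : p ^ n ∣ (io p f).coeff (-n) := by
  refine B_ind p (P := fun f => p ^ n ∣ (io p f).coeff (-n)) f ?_ ?_ ?_
  · intro a b ha hb; rw [map_add, coeff_add']; exact dvd_add ha hb
  · intro m h; rw [io_xn, mo_coeff]; split_ifs with h1
    · have : n = 0 := by omega
      subst this; simp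
    · exact dvd_zero _
  · intro m h; rw [io_yn, mo_coeff]; split_ifs with h1
    · have : m = n := by omega
      subst this; exact dvd_mul_right _ _
    · exact dvd_zero _

lemma exists_io (F : S) (hF : ∀ n : ℕ, p ^ n ∣ F.coeff (-n)) : ∃ f, io p f = F := by
  have : ∀ n : ℤ, ∃ f, io p f = mo n (F.coeff n) := by
    intro n
    obtain ⟨k, rfl | rfl⟩ := n.eq_nat_or_neg
    · exact ⟨_, io_xn p k _⟩
    · obtain ⟨h, hh⟩ := hF k
      exact ⟨_, (io_yn p k h).trans (by rw [hh])⟩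
  choose e he using this
  refine ⟨∑ n ∈ F.coeff.support, e n, ?_⟩
  rw [map_sum]
  apply S_ext
  intro k
  rw [AddMonoidAlgebra.coeff_sum, Finsupp.finsetSum_apply]
  simp only [he, mo_coeff]
  rw [Finset.sum_ite_eq']
  split_ifs with h
  · rfl
  · exact (Finsupp.notMem_support_iff.1 h).symm

variable {p}

lemma nf (f : BpAlg p) : ∃ A B : Polynomial (Polynomial ℂ),
    f = A.sum (fun n h => bx p ^ n * Polynomial.aeval (bz p) h)
      + B.sum (fun n h => by' p ^ (n + 1) * Polynomial.aeval (bz p) h) := by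
  refine B_ind p f (P := fun f => ∃ A B : Polynomial (Polynomial ℂ),
    f = A.sum (fun n h => bx p ^ n * Polynomial.aeval (bz p) h)
      + B.sum (fun n h => by' p ^ (n + 1) * Polynomial.aeval (bz p) h)) ?_ ?_ ?_
  · rintro f g ⟨A, B, rfl⟩ ⟨A', B', rfl⟩
    refine ⟨A + A', B + B', ?_⟩
    rw [Polynomial.sum_add_index, Polynomial.sum_add_index]
    · ring
    all_goals simp [mul_add]
  · intro n h
    exact ⟨Polynomial.monomial n h, 0, by simp [Polynomial.sum_monomial_index]⟩
  · intro n h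
    rcases n with _ | n
    · exact ⟨Polynomial.monomial 0 h, 0, by rw [Polynomial.sum_monomial_index] <;> simp⟩
    · exact ⟨0, Polynomial.monomial n h, by simp [Polynomial.sum_monomial_index]⟩

lemma io_inj (hp : p ≠ 0) : Function.Injective (io p) := by
  rw [injective_iff_map_eq_zero]
  intro f hf
  obtain ⟨A, B, rfl⟩ := nf f
  have e : ∀ k : ℤ, (A.sum fun n h => (mo n h).coeff k) + (B.sum fun n h => (mo (-(n+1:ℕ)) (p ^ (n+1) * h)).coeff k) = 0 := by
    intro k
    have := congrArg (fun F : S => F.coeff k) hf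
    simp only [Polynomial.sum, map_add, map_sum, io_xn, io_yn, coeff_add', AddMonoidAlgebra.coeff_sum,
      Finsupp.finsetSum_apply] at this
    exact this
  simp only [mo_coeff, Polynomial.sum] at e
  have hA : A = 0 := by
    ext1 n
    have := e n
    rw [Finset.sum_eq_zero (s := B.support)] at this
    · simpa using this
    · intro m _; rw [if_neg]; push_cast; omega
  have hB : B = 0 := by
    ext1 n
    have := e (-(n + 1 : ℕ))
    rw [Finset.sum_eq_zero (s := A.support)] at this
    · simp only [neg_inj, Nat.cast_inj, Nat.add_right_cancel_iff, zero_add, Finset.sum_ite_eq',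
        Polynomial.mem_support_iff] at this
      by_contra hb
      rw [if_pos (by simpa using hb)] at this
      exact (mul_ne_zero (pow_ne_zero _ hp) (by simpa using hb)) this
    · intro m _; rw [if_neg]; push_cast; omega
  subst hA hB
  simp

lemma x_cancel (hp : p ≠ 0) {f g : BpAlg p} (h : bx p * f = bx p * g) : f = g := by
  apply io_inj hp
  have := congrArg (fun u => mo (-1) 1 * io p u) h
  simpa [← mul_assoc, mo_mul, mo_one] using this

lemma br_closed (f g : BpAlg p) : ∃ h, io p h = br (io p f) (io p g) := by
  have main : ∀ F : S, (∃ h, io p h = br F (io p (bx p))) → (∃ h, io p h = br F (io p (by' p))) →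
      (∃ h, io p h = br F (io p (bz p))) → ∀ g, ∃ h, io p h = br F (io p g) := by
    rintro F ⟨hx, ex⟩ ⟨hy, ey⟩ ⟨hz, ez⟩ g
    refine gen_ind p (P := fun g => ∃ h, io p h = br F (io p g)) g ?_ ?_ ?_ ?_ ?_
    · intro c; refine ⟨0, ?_⟩; rw [AlgHom.commutes, br_const_right, map_zero]
    · rintro a b ⟨a', ha⟩ ⟨b', hb⟩; exact ⟨a' + b', by rw [map_add, map_add, br_add_right, ha, hb]⟩
    · rintro a ⟨a', ha⟩; exact ⟨a' * bx p + a * hx, by rw [map_mul, br_mul_right, map_add, map_mul, map_mul, ha, ex]⟩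
    · rintro a ⟨a', ha⟩; exact ⟨a' * by' p + a * hy, by rw [map_mul, br_mul_right, map_add, map_mul, map_mul, ha, ey]⟩
    · rintro a ⟨a', ha⟩; exact ⟨a' * bz p + a * hz, by rw [map_mul, br_mul_right, map_add, map_mul, map_mul, ha, ez]⟩
  have sw : ∀ F G : S, (∃ h, io p h = br F G) → (∃ h, io p h = br G F) := by
    rintro F G ⟨h, e⟩; exact ⟨-h, by rw [map_neg, e, br_skew F G, neg_neg]⟩
  have xy : ∃ h, io p h = br (io p (bx p)) (io p (by' p)) :=
    ⟨Polynomial.aeval (bz p) (Polynomial.derivative p), by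
      rw [io_hz, io_x, io_y, br_x, dz_mo, mo_mul]; simp⟩
  have xz : ∃ h, io p h = br (io p (bx p)) (io p (bz p)) :=
    ⟨bx p, by rw [io_x, io_z, br_x, dz_mo, mo_mul]; simp⟩
  have yz : ∃ h, io p h = br (io p (by' p)) (io p (bz p)) :=
    ⟨- by' p, by rw [map_neg, io_y, io_z, br, th_mo, dz_mo, dz_mo, th_mo]; simp [mo_zero, mo_mul]; simp [mo]⟩
  have s : ∀ f, ∃ h, io p h = br (io p f) (io p f) := fun f => ⟨0, by rw [br_self, map_zero]⟩
  refine main _ ?_ ?_ ?_ g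
  · exact sw _ _ (main _ (s _) xy xz f)
  · exact sw _ _ (main _ (sw _ _ xy) (s _) yz f)
  · exact sw _ _ (main _ (sw _ _ xz) (sw _ _ yz) (s _) f)

noncomputable def bb (f g : BpAlg p) : BpAlg p := (br_closed f g).choose
lemma io_bb (f g : BpAlg p) : io p (bb f g) = br (io p f) (io p g) := (br_closed f g).choose_spec

end
end Dan

namespace Dan

section
variable {p : Polynomial ℂ}

structure IsBD (β : BpAlg p → BpAlg p → BpAlg p) : Prop where
  add : ∀ f g h, β f (g + h) = β f g + β f h
  mul : ∀ f g h, β f (g * h) = β f g * h + g * β f h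
  const : ∀ f (c : ℂ), β f (algebraMap ℂ _ c) = 0
  skew : ∀ f g, β f g = - β g f

lemma bb_isBD (hp : p ≠ 0) : IsBD (bb (p := p)) where
  add f g h := io_inj hp (by simp only [io_bb, map_add, br_add_right])
  mul f g h := io_inj hp (by simp only [io_bb, map_add, map_mul, br_mul_right])
  const f c := io_inj hp (by simp only [io_bb, AlgHom.commutes, br_const_right, map_zero])
  skew f g := io_inj hp (by rw [io_bb, map_neg, io_bb, br_skew])

lemma IsBD.self {β : BpAlg p → BpAlg p → BpAlg p} (h : IsBD β) (f : BpAlg p) : β f f = 0 := by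
  have := h.skew f f
  have h2 : (2 : ℂ) • β f f = 0 := by
    rw [two_smul]; nth_rewrite 1 [this]; ring
  exact (smul_eq_zero.1 h2).resolve_left (by norm_num)

lemma IsBD.poly {β : BpAlg p → BpAlg p → BpAlg p} (h : IsBD β) (f : BpAlg p) (q : Polynomial ℂ) :
    β f (Polynomial.aeval (bz p) q) = Polynomial.aeval (bz p) (Polynomial.derivative q) * β f (bz p) := by
  induction q using Polynomial.induction_on with
  | C a => simp [h.const]
  | add a b ha hb => simp only [map_add, h.add, ha, hb]; ring
  | monomial n a ih =>
    rw [pow_succ, ← mul_assoc]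
    generalize Polynomial.C a * Polynomial.X ^ n = q at ih ⊢
    rw [map_mul, h.mul, ih, Polynomial.aeval_X, Polynomial.derivative_mul, Polynomial.derivative_X,
      mul_one, map_add, map_mul, Polynomial.aeval_X]
    ring

lemma IsBD.zero {β : BpAlg p → BpAlg p → BpAlg p} (h : IsBD β) (xz : β (bx p) (bz p) = 0)
    (yz : β (by' p) (bz p) = 0) (xy : β (bx p) (by' p) = 0) (f g : BpAlg p) : β f g = 0 := by
  have main : ∀ F, β F (bx p) = 0 → β F (by' p) = 0 → β F (bz p) = 0 → ∀ g, β F g = 0 := by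
    intro F hx hy hz g
    refine gen_ind p (P := fun g => β F g = 0) g (h.const F) ?_ ?_ ?_ ?_
    · intro a b ha hb; rw [h.add, ha, hb, add_zero]
    · intro a ha; rw [h.mul, ha, hx]; simp
    · intro a ha; rw [h.mul, ha, hy]; simp
    · intro a ha; rw [h.mul, ha, hz]; simp
  have sw : ∀ F G, β F G = 0 → β G F = 0 := by intro F G e; rw [h.skew, e, neg_zero]
  refine main _ ?_ ?_ ?_ g
  · exact sw _ _ (main _ (h.self _) xy xz f)
  · exact sw _ _ (main _ (sw _ _ xy) (h.self _) yz f)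
  · exact sw _ _ (main _ (sw _ _ xz) (sw _ _ yz) (h.self _) f)

lemma bb_xz (hp : p ≠ 0) : bb (bx p) (bz p) = bx p := io_inj hp (by
  rw [io_bb, io_x, io_z, br_x, dz_mo, mo_mul]; simp)
lemma bb_yz (hp : p ≠ 0) : bb (by' p) (bz p) = - by' p := io_inj hp (by
  rw [io_bb, map_neg, io_y, io_z, br, th_mo, dz_mo, dz_mo, th_mo]; simp [mo_zero, mo_mul]; simp [mo])
lemma bb_xy (hp : p ≠ 0) : bb (bx p) (by' p) = Polynomial.aeval (bz p) (Polynomial.derivative p) :=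
  io_inj hp (by rw [io_bb, io_hz, io_x, io_y, br_x, dz_mo, mo_mul]; simp)

lemma IsBD.exists_eta (hp : p ≠ 0) {β : BpAlg p → BpAlg p → BpAlg p} (h : IsBD β) :
    ∃ η, ∀ f g, β f g = η * bb f g := by
  have e1 : β (bz p) (bx p) * by' p + bx p * β (bz p) (by' p) = 0 := by
    rw [← h.mul, rel, h.poly, h.self, mul_zero]
  have e2 : by' p * β (bx p) (bz p) + bx p * β (by' p) (bz p) = 0 := by
    rw [h.skew (bx p), h.skew (by' p)]; linear_combination -e1
  obtain ⟨η, hη⟩ := exists_io p (mo (-1) 1 * io p (β (bx p) (bz p))) (by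
    intro n
    rw [coeff_mo_mul, one_mul]
    have e3 := congrArg (fun u => (mo (-1) 1 * io p u).coeff (-(n + 1 : ℕ))) e2
    simp only [map_add, map_mul, io_x, io_y, mul_add, ← mul_assoc, mo_mul, coeff_add', coeff_mo_mul,
      map_zero, mul_zero] at e3
    have e4 := io_dvd p (β (by' p) (bz p)) (n + 1)
    have e5 : p * (io p (β (bx p) (bz p))).coeff (-n - -1) = - (io p (β (by' p) (bz p))).coeff (-(n + 1 : ℕ)) := by
      rw [eq_neg_iff_add_eq_zero]
      have z1 : (-((n + 1 : ℕ) : ℤ) - (-1 + -1)) = -n - -1 := by push_cast; ring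
      have z2 : (-((n + 1 : ℕ) : ℤ) - (-1 + 1)) = -((n + 1 : ℕ) : ℤ) := by ring
      rw [z1, z2, one_mul, one_mul, one_mul] at e3
      exact e3
    have e6 : p * p ^ n ∣ p * (io p (β (bx p) (bz p))).coeff (-n - -1) := by
      rw [e5, dvd_neg, ← pow_succ']; exact e4
    exact (mul_dvd_mul_iff_left hp).1 e6)
  have h1 : β (bx p) (bz p) = bx p * η := io_inj hp (by
    rw [map_mul, hη, io_x, ← mul_assoc, mo_mul]; simp [mo_one])
  have h2 : β (by' p) (bz p) = - (by' p * η) := x_cancel hp (by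
    rw [h1] at e2; linear_combination e2)
  have h3 : β (bx p) (by' p) = Polynomial.aeval (bz p) (Polynomial.derivative p) * η := x_cancel hp (by
    have := h.mul (bx p) (bx p) (by' p)
    rw [rel, h.poly, h.self, h1] at this
    linear_combination -this)
  have b := bb_isBD hp
  have hd : IsBD (fun f g => β f g - η * bb f g) := by
    constructor
    · intro f g k; simp only [h.add, b.add]; ring
    · intro f g k; simp only [h.mul, b.mul]; ring
    · intro f c; simp only [h.const, b.const]; ring
    · intro f g; beta_reduce; rw [h.skew f g, b.skew f g]; ring
  refine ⟨η, fun f g => ?_⟩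
  have := hd.zero (by rw [h1, bb_xz hp]; ring) (by rw [h2, bb_yz hp]; ring)
    (by rw [h3, bb_xy hp]; ring) f g
  exact sub_eq_zero.1 this

lemma mul_one_top {u v : S} (h : u * v = 1) : ∃ a, Le a u ∧ Le (-a) v ∧ u.coeff a ≠ 0 ∧ v.coeff (-a) ≠ 0 := by
  have hu : u ≠ 0 := by rintro rfl; simp at h
  have hv : v ≠ 0 := by rintro rfl; simp at h
  obtain ⟨a, ha, ha'⟩ := exists_top hu
  obtain ⟨b, hb, hb'⟩ := exists_top hv
  have : a + b = 0 := by
    by_contra hab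
    have h1 := (ha.mul hb).2
    rw [h, ← mo_one, mo_coeff, if_neg (by omega)] at h1
    exact mul_ne_zero ha' hb' h1.symm
  have : b = -a := by omega
  subst this
  exact ⟨a, ha, hb, ha', hb'⟩

lemma unit_const (hp : p.natDegree ≠ 0) {u v : BpAlg p} (h : u * v = 1) :
    ∃ c : ℂ, c ≠ 0 ∧ u = algebraMap ℂ _ c := by
  have hp0 : p ≠ 0 := by rintro rfl; simp at hp
  have hnu : ∀ n : ℕ, n ≠ 0 → ¬ IsUnit (p ^ n) := by
    intro n hn hu
    rw [isUnit_pow_iff hn] at hu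
    exact hp (Polynomial.natDegree_eq_zero_of_isUnit hu)
  have h1 : io p u * io p v = 1 := by rw [← map_mul, h, map_one]
  obtain ⟨a, ha, hb, ha', hb'⟩ := mul_one_top h1
  have h2 : LaurentPolynomial.invert (io p u) * LaurentPolynomial.invert (io p v) = 1 := by
    rw [← map_mul, h1, map_one]
  obtain ⟨a2, ha2, hb2, ha2', hb2'⟩ := mul_one_top h2
  have ic : ∀ (f : S) n, (LaurentPolynomial.invert f).coeff n = f.coeff (-n) := by intro f n; simp
  have haa : a2 = -a := by
    rw [ic] at ha2' hb2'
    have := not_lt.1 (fun hlt => ha2' (ha _ hlt))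
    have := not_lt.1 (fun hlt => hb2' (hb _ hlt))
    omega
  subst haa
  have hU : io p u = mo a ((io p u).coeff a) := by
    apply S_ext; intro k; rw [mo_coeff]
    split_ifs with h
    · rw [h]
    · rcases lt_or_gt_of_ne h with h | h
      · exact ha _ h
      · have := ha2 (-k) (by omega); rw [ic, neg_neg] at this; exact this
  have hPQ : (io p u).coeff a * (io p v).coeff (-a) = 1 := by
    rw [← (ha.mul hb).2, h1, ← mo_one, mo_coeff, if_pos (by ring)]
  have hPu : IsUnit ((io p u).coeff a) := IsUnit.of_mul_eq_one _ hPQ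
  have hQu : IsUnit ((io p v).coeff (-a)) := IsUnit.of_mul_eq_one _ ((mul_comm _ _).trans hPQ)
  have ha0 : a = 0 := by
    obtain ⟨n, rfl | rfl⟩ := a.eq_nat_or_neg
    · by_contra hn
      exact hnu n (by omega) (isUnit_of_dvd_unit (io_dvd p v n) hQu)
    · by_contra hn
      exact hnu n (by omega) (isUnit_of_dvd_unit (io_dvd p u n) hPu)
  subst ha0
  obtain ⟨c, hc, hc'⟩ := Polynomial.isUnit_iff.1 hPu
  refine ⟨c, hc.ne_zero, io_inj hp0 ?_⟩
  rw [hU, ← hc', AlgHom.commutes, algMap_eq]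

def SL (φ : BpAlg p ≃+* BpAlg p) : Prop :=
  ∀ (c : ℂ) (f : BpAlg p), φ (c • f) = (starRingEnd ℂ) c • φ f

lemma SL.alg {φ : BpAlg p ≃+* BpAlg p} (h : SL φ) (c : ℂ) :
    φ (algebraMap ℂ _ c) = algebraMap ℂ _ ((starRingEnd ℂ) c) := by
  rw [Algebra.algebraMap_eq_smul_one, h, map_one, ← Algebra.algebraMap_eq_smul_one]

lemma SL.symm {φ : BpAlg p ≃+* BpAlg p} (h : SL φ) : SL φ.symm := by
  intro c f
  apply φ.injective
  rw [h, RingEquiv.apply_symm_apply, RingEquiv.apply_symm_apply, Complex.conj_conj]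

lemma SL.eta (hp : p ≠ 0) {φ : BpAlg p ≃+* BpAlg p} (h : SL φ) :
    ∃ η, ∀ f g, bb (φ f) (φ g) = η * φ (bb f g) := by
  have b := bb_isBD hp
  have : IsBD (fun f g => φ.symm (bb (φ f) (φ g))) := by
    constructor
    · intro f g k; simp [b.add]
    · intro f g k; simp [b.mul]
    · intro f c; beta_reduce; rw [h.alg, b.const, map_zero]
    · intro f g; beta_reduce; rw [b.skew, map_neg]
  obtain ⟨η, hη⟩ := this.exists_eta hp
  refine ⟨φ η, fun f g => ?_⟩
  rw [← map_mul, ← hη, RingEquiv.apply_symm_apply]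

lemma SL.mu (hp : p.natDegree ≠ 0) {φ : BpAlg p ≃+* BpAlg p} (h : SL φ) :
    ∃ μ : ℂ, μ ≠ 0 ∧ ∀ f g, bb (φ f) (φ g) = algebraMap ℂ _ μ * φ (bb f g) := by
  have hp0 : p ≠ 0 := by rintro rfl; simp at hp
  obtain ⟨η, h1⟩ := h.eta hp0
  obtain ⟨η2, h2⟩ := h.symm.eta hp0
  have e := h1 (φ.symm (bx p)) (φ.symm (bz p))
  rw [h2, map_mul] at e
  simp only [RingEquiv.apply_symm_apply, bb_xz hp0] at e
  have : η * φ η2 = 1 := x_cancel hp0 (by linear_combination -e)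
  obtain ⟨c, hc, rfl⟩ := unit_const hp this
  exact ⟨c, hc, h1⟩

lemma nil_x (G : S) : ∃ n, (br (mo 1 1))^[n] G = 0 := by
  have it : ∀ n : ℕ, (br (mo 1 1))^[n] G = mo n 1 * dz^[n] G := by
    intro n
    induction n with
    | zero => simp [mo_one]
    | succ n ih =>
      rw [Function.iterate_succ_apply', ih, br_x, dz_mul, dz_mo, Function.iterate_succ_apply', mul_add,
        ← mul_assoc, ← mul_assoc, mo_mul, mo_mul]
      simp [mo_zero, add_comm]
  have ic : ∀ (n : ℕ) k, (dz^[n] G).coeff k = Polynomial.derivative^[n] (G.coeff k) := by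
    intro n k
    induction n with
    | zero => rfl
    | succ n ih => rw [Function.iterate_succ_apply', dz_coeff, ih, Function.iterate_succ_apply']
  refine ⟨G.coeff.support.sup (fun k => (G.coeff k).natDegree) + 1, ?_⟩
  rw [it]
  convert mul_zero _
  apply S_ext
  intro k
  rw [ic]
  by_cases hk : k ∈ G.coeff.support
  · exact Polynomial.iterate_derivative_eq_zero (Nat.lt_succ_of_le
      (Finset.le_sup (f := fun k => (G.coeff k).natDegree) hk))
  · rw [Finsupp.notMem_support_iff.1 hk]; simp

lemma SL.nil (hp : p.natDegree ≠ 0) {φ : BpAlg p ≃+* BpAlg p} (h : SL φ) (g : BpAlg p) :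
    ∃ n, (br (io p (φ (bx p))))^[n] (io p g) = 0 := by
  have hp0 : p ≠ 0 := by rintro rfl; simp at hp
  obtain ⟨μ, _, hμ⟩ := h.mu hp
  have i1 : ∀ (X g : BpAlg p) (n : ℕ), (br (io p X))^[n] (io p g) = io p ((bb X)^[n] g) := by
    intro X g n
    induction n with
    | zero => rfl
    | succ n ih => rw [Function.iterate_succ_apply', ih, Function.iterate_succ_apply', io_bb]
  have b := bb_isBD hp0
  have i2 : ∀ (g : BpAlg p) (n : ℕ), (bb (φ (bx p)))^[n] (φ g) = algebraMap ℂ _ (μ ^ n) * φ ((bb (bx p))^[n] g) := by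
    intro g n
    induction n with
    | zero => simp
    | succ n ih =>
      rw [Function.iterate_succ_apply', ih, b.mul, b.const, hμ, Function.iterate_succ_apply', pow_succ, map_mul]; ring
  obtain ⟨n, hn⟩ := nil_x (io p (φ.symm g))
  refine ⟨n, ?_⟩
  have h3 : (bb (bx p))^[n] (φ.symm g) = 0 := io_inj hp0 (by rw [← i1, io_x, hn, map_zero])
  have := i2 (φ.symm g) n
  rw [h3, map_zero, mul_zero, RingEquiv.apply_symm_apply] at this
  rw [i1, this, map_zero]

end
end Dan

namespace Dan

section
variable {p : Polynomial ℂ}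

lemma ne_zero_of (hp : p.natDegree ≠ 0) : p ≠ 0 := by rintro rfl; simp at hp

lemma psi_le {N M : ℤ} (hN : N ≠ 0) {f : S} {W : ℤ} (h : Le W (psi N M f)) {n : ℤ} {m : ℕ}
    (hc : (f.coeff n).coeff m ≠ 0) : N * n + M * m ≤ W := by
  by_contra hlt
  rw [← psi_coeff N M hN, h _ (not_le.1 hlt)] at hc
  simp at hc

lemma psi_y (N M : ℤ) (hM : 0 ≤ M) (hp : p.natDegree ≠ 0) (hN : N ≠ 0) :
    Le (-N + M * p.natDegree) (psi N M (mo (-1) p)) ∧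
    (psi N M (mo (-1) p)).coeff (-N + M * p.natDegree) ≠ 0 ∧
    ((psi N M (mo (-1) p)).coeff (-N + M * p.natDegree)).natDegree = p.natDegree := by
  have hp0 := ne_zero_of hp
  have key : ∀ W (m : ℕ), ((psi N M (mo (-1) p)).coeff W).coeff m ≠ 0 → W = -N + M * m ∧ m ≤ p.natDegree := by
    intro W m h
    obtain ⟨n, rfl⟩ := psi_coeff_ne _ _ _ _ _ h
    rw [psi_coeff _ _ hN, mo_coeff] at h
    split_ifs at h with h1
    · subst h1; exact ⟨by ring, Polynomial.le_natDegree_of_ne_zero h⟩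
    · simp at h
  have top : ((psi N M (mo (-1) p)).coeff (-N + M * p.natDegree)).coeff p.natDegree ≠ 0 := by
    have := psi_coeff N M hN (mo (-1) p) (-1) p.natDegree
    rw [mo_coeff, if_pos rfl, mul_neg_one] at this
    rw [this]; simpa using hp0
  refine ⟨?_, ?_, ?_⟩
  · intro k hk
    ext m
    by_contra h
    rw [Polynomial.coeff_zero] at h
    obtain ⟨h1, h2⟩ := key _ _ h
    have : M * m ≤ M * p.natDegree := mul_le_mul_of_nonneg_left (by exact_mod_cast h2) hM
    omega
  · intro h; rw [h] at top; simp at top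
  · apply le_antisymm
    · rw [Polynomial.natDegree_le_iff_coeff_eq_zero]
      intro m hm
      by_contra h
      have := (key _ _ h).2
      omega
    · exact Polynomial.le_natDegree_of_ne_zero top

lemma psi_x (N M : ℤ) : psi N M (mo 1 1) = mo N 1 := by
  have := psi_mono N M 1 0 1
  simpa using this

lemma cone (hp : p.natDegree ≠ 0) (f : BpAlg p) (n : ℤ) (h : (io p f).coeff n ≠ 0) :
    0 ≤ p.natDegree * n + ((io p f).coeff n).natDegree := by
  obtain ⟨k, rfl | rfl⟩ := n.eq_nat_or_neg
  · positivity
  · have := Polynomial.natDegree_le_of_dvd (io_dvd p f k) h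
    rw [Polynomial.natDegree_pow] at this
    have : ((k * p.natDegree : ℕ) : ℤ) ≤ ((io p f).coeff (-k)).natDegree := by exact_mod_cast this
    push_cast at this
    linarith

lemma S_coeff_ne {f : S} {n : ℤ} {m : ℕ} (h : (f.coeff n).coeff m ≠ 0) : f.coeff n ≠ 0 := by
  intro h0; rw [h0] at h; simp at h

lemma face (hp : p.natDegree ≠ 0) {φ : BpAlg p ≃+* BpAlg p} (h : SL φ) (N M : ℤ) (hN : 0 < N)
    (hM : 0 ≤ M) : ∃ (n : ℤ) (m : ℕ), Le (N * n + M * m) (psi N M (io p (φ (bx p)))) ∧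
      ((io p (φ (bx p))).coeff n).coeff m ≠ 0 ∧
      ((0 ≤ n ∧ m = 0) ∨ (n ≤ 0 ∧ (m : ℤ) = - p.natDegree * n)) := by
  have hp0 := ne_zero_of hp
  set X := io p (φ (bx p)) with hX
  have hbx : bx p ≠ 0 := by
    intro h0
    have := congrArg (fun u => (io p u).coeff 1) h0
    simp [mo_coeff] at this
  have hX0 : X ≠ 0 := by
    rw [hX, ← map_zero (io p)]
    intro h0
    have := io_inj hp0 h0
    rw [← map_zero φ] at this
    exact hbx (φ.injective this)
  have hpsi : psi N M X ≠ 0 := by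
    obtain ⟨a, _, ha⟩ := exists_top hX0
    obtain ⟨m, hm⟩ : ∃ m, (X.coeff a).coeff m ≠ 0 := by
      by_contra hc; push Not at hc; exact ha (Polynomial.ext (by simpa using hc))
    intro h0
    rw [← psi_coeff N M hN.ne', h0] at hm
    simp at hm
  obtain ⟨W, hW, hP⟩ := exists_top hpsi
  obtain ⟨n, hn⟩ := psi_coeff_ne N M X W _ (by
    rw [Polynomial.coeff_natDegree]; exact Polynomial.leadingCoeff_ne_zero.2 hP)
  have hc : (X.coeff n).coeff ((psi N M X).coeff W).natDegree ≠ 0 := by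
    rw [← psi_coeff N M hN.ne', ← hn, Polynomial.coeff_natDegree]
    exact Polynomial.leadingCoeff_ne_zero.2 hP
  generalize hm : ((psi N M X).coeff W).natDegree = m at hn hc
  refine ⟨n, m, hn ▸ hW, hc, ?_⟩
  obtain ⟨n1, h1⟩ := h.nil hp (bx p)
  obtain ⟨n2, h2⟩ := h.nil hp (by' p)
  rw [io_x] at h1
  rw [io_y] at h2
  obtain ⟨k, hk⟩ := nil_deg N M hN.ne' hW m hP hm n1 (mo 1 1) N 0
    (by rw [psi_x]; intro k hk; rw [mo_coeff, if_neg (by omega)])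
    (by rw [psi_x, mo_coeff, if_pos rfl]; simp) (by rw [psi_x, mo_coeff, if_pos rfl]; simp) h1
  obtain ⟨y1, y2, y3⟩ := psi_y N M hM hp hN.ne'
  obtain ⟨k', hk'⟩ := nil_deg N M hN.ne' hW m hP hm n2 (mo (-1) p) _ _ y1 y2 y3 h2
  have e1 : -(m : ℤ) = k * n := by
    apply mul_left_cancel₀ hN.ne'
    rw [hn] at hk; push_cast at hk
    linear_combination hk
  have e2 : (p.natDegree : ℤ) * n + m = k' * n := by
    apply mul_left_cancel₀ hN.ne'
    rw [hn] at hk'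
    linear_combination hk'
  rcases le_total 0 n with h0 | h0
  · left
    refine ⟨h0, ?_⟩
    have : 0 ≤ (k : ℤ) * n := by positivity
    omega
  · right
    refine ⟨h0, ?_⟩
    have h3 : (k' : ℤ) * n ≤ 0 := mul_nonpos_of_nonneg_of_nonpos (by positivity) h0
    have h4 := cone hp (φ (bx p)) n (S_coeff_ne hc)
    have h5 : X.coeff n ≠ 0 := S_coeff_ne hc
    have h5' : (X.coeff n).coeff (X.coeff n).natDegree ≠ 0 := by
      rw [Polynomial.coeff_natDegree]; exact Polynomial.leadingCoeff_ne_zero.2 h5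
    have h6 : (X.coeff n).natDegree ≤ m := by
      have := psi_le hN.ne' hW h5'
      rw [hn] at this
      rcases hM.eq_or_lt with rfl | hM
      · rw [← psi_coeff N 0 hN.ne'] at h5'
        rw [← hm, hn]
        simp only [zero_mul, add_zero] at h5' ⊢
        exact Polynomial.le_natDegree_of_ne_zero h5'
      · have h7 := le_of_mul_le_mul_left (le_of_add_le_add_left this) hM
        exact_mod_cast h7
    have h8 : ((X.coeff n).natDegree : ℤ) ≤ m := by exact_mod_cast h6
    rw [← hX] at h4
    linarith


def EE (i : ℕ) (F : S) (d : ℕ) : Prop := ∀ (n : ℤ) (m : ℕ), (F.coeff n).coeff m ≠ 0 → d * n + m ≤ d * i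
def FF (j : ℕ) (F : S) (d : ℕ) : Prop := ∀ (n : ℤ) (m : ℕ), (F.coeff n).coeff m ≠ 0 → m ≤ d * j

lemma faceE (hp : p.natDegree ≠ 0) {φ : BpAlg p ≃+* BpAlg p} (h : SL φ) :
    ∃ i : ℕ, EE i (io p (φ (bx p))) p.natDegree ∧ (i = 0 ∨ ((io p (φ (bx p))).coeff i).coeff 0 ≠ 0) := by
  have hN : 0 < (p.natDegree : ℤ) := by omega
  obtain ⟨n, m, hW, hc, h1 | h1⟩ := face hp h p.natDegree 1 hN (by norm_num)
  · obtain ⟨h1, rfl⟩ := h1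
    obtain ⟨i, rfl⟩ := Int.eq_ofNat_of_zero_le h1
    refine ⟨i, ?_, Or.inr hc⟩
    intro n m hnm
    have := psi_le hN.ne' hW hnm
    push_cast at this
    linarith
  · refine ⟨0, ?_, Or.inl rfl⟩
    intro n' m' hnm
    have := psi_le hN.ne' hW hnm
    push_cast
    linarith

lemma faceF (hp : p.natDegree ≠ 0) {φ : BpAlg p ≃+* BpAlg p} (h : SL φ) :
    ∃ j : ℕ, FF j (io p (φ (bx p))) p.natDegree ∧
      (j = 0 ∨ ((io p (φ (bx p))).coeff (-j)).coeff (p.natDegree * j) ≠ 0) := by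
  set X := io p (φ (bx p)) with hX
  obtain ⟨L, hL0, hL⟩ : ∃ L : ℤ, 0 ≤ L ∧ ∀ n, X.coeff n ≠ 0 → |n| ≤ L := by
    refine ⟨(X.coeff.support.sup (fun n => n.natAbs) : ℕ), by positivity, ?_⟩
    intro n hn
    have := Finset.le_sup (f := fun n : ℤ => n.natAbs) (Finsupp.mem_support_iff.2 hn)
    rw [Int.abs_eq_natAbs]
    exact_mod_cast this
  obtain ⟨n, m, hW, hc, h1⟩ := face hp h 1 (2 * L + 1) one_pos (by omega)
  have key : ∀ (n' : ℤ) (m' : ℕ), (X.coeff n').coeff m' ≠ 0 → m' ≤ m := by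
    intro n' m' hnm
    have := psi_le one_ne_zero hW hnm
    have a1 := abs_le.1 (hL n (S_coeff_ne hc))
    have a2 := abs_le.1 (hL n' (S_coeff_ne hnm))
    by_contra hlt
    have h3 : (m : ℤ) + 1 ≤ m' := by omega
    have : (2 * L + 1) * (m + 1 : ℤ) ≤ (2 * L + 1) * m' := mul_le_mul_of_nonneg_left h3 (by omega)
    linarith
  rcases h1 with ⟨h1, rfl⟩ | ⟨h1, h2⟩
  · exact ⟨0, fun n' m' hnm => by simpa using key n' m' hnm, Or.inl rfl⟩
  · obtain ⟨j, hj⟩ : ∃ j : ℕ, n = -j := ⟨n.natAbs, by omega⟩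
    subst hj
    have : m = p.natDegree * j := by zify; linarith
    subst this
    exact ⟨j, key, Or.inr hc⟩

/-- exchange of the two generators -/
noncomputable def swapHom (p : Polynomial ℂ) : BpAlg p →ₐ[ℂ] BpAlg p :=
  blift (by' p) (bx p) (bz p) (by rw [mul_comm, rel])

lemma swap_swap (f : BpAlg p) : swapHom p (swapHom p f) = f := by
  have := bhom_ext p ((swapHom p).comp (swapHom p)) (AlgHom.id ℂ _) (by simp [swapHom]) (by simp [swapHom])
    (by simp [swapHom]) f
  simpa using this

noncomputable def swap (p : Polynomial ℂ) : BpAlg p ≃ₐ[ℂ] BpAlg p :=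
  AlgEquiv.ofAlgHom (swapHom p) (swapHom p) (AlgHom.ext swap_swap) (AlgHom.ext swap_swap)

lemma swap_coeff (f : BpAlg p) (n : ℕ) :
    (io p (swapHom p f)).coeff (-n) = p ^ n * (io p f).coeff n := by
  refine B_ind p (P := fun f => (io p (swapHom p f)).coeff (-n) = p ^ n * (io p f).coeff n) f ?_ ?_ ?_
  · intro a b ha hb; rw [map_add, map_add, map_add, coeff_add', coeff_add', ha, hb]; ring
  · intro k h
    have : swapHom p (bx p ^ k * Polynomial.aeval (bz p) h) = by' p ^ k * Polynomial.aeval (bz p) h := by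
      rw [map_mul, map_pow, ← Polynomial.aeval_algHom_apply]; simp [swapHom]
    rw [this, io_xn, io_yn, mo_coeff, mo_coeff]
    by_cases hk : k = n
    · subst hk; simp
    · rw [if_neg (by omega), if_neg (by omega), mul_zero]
  · intro k h
    have : swapHom p (by' p ^ k * Polynomial.aeval (bz p) h) = bx p ^ k * Polynomial.aeval (bz p) h := by
      rw [map_mul, map_pow, ← Polynomial.aeval_algHom_apply]; simp [swapHom]
    rw [this, io_xn, io_yn, mo_coeff, mo_coeff]
    by_cases hk : k = 0 ∧ n = 0
    · obtain ⟨rfl, rfl⟩ := hk; simp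
    · rw [if_neg (by omega), if_neg (by omega), mul_zero]

lemma swap_deg (hp : p.natDegree ≠ 0) (f : BpAlg p) (n : ℤ) (h : (io p (swapHom p f)).coeff n ≠ 0) :
    (io p f).coeff (-n) ≠ 0 ∧ (((io p f).coeff (-n)).natDegree : ℤ) =
      ((io p (swapHom p f)).coeff n).natDegree + p.natDegree * n := by
  have hp0 := ne_zero_of hp
  obtain ⟨k, rfl | rfl⟩ := n.eq_nat_or_neg
  · have := swap_coeff (swapHom p f) k
    rw [swap_swap] at this
    rw [this, Polynomial.natDegree_mul (pow_ne_zero _ hp0) h, Polynomial.natDegree_pow]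
    refine ⟨mul_ne_zero (pow_ne_zero _ hp0) h, ?_⟩
    push_cast; ring
  · have := swap_coeff f k
    rw [this] at h
    have h2 := right_ne_zero_of_mul h
    rw [this, neg_neg, Polynomial.natDegree_mul (pow_ne_zero _ hp0) h2, Polynomial.natDegree_pow]
    refine ⟨h2, ?_⟩
    push_cast; ring

lemma EE_iff {i d : ℕ} {F : S} : EE i F d ↔ ∀ n, F.coeff n ≠ 0 → (d : ℤ) * n + (F.coeff n).natDegree ≤ d * i := by
  constructor
  · intro h n hn
    exact h n _ (by rw [Polynomial.coeff_natDegree]; exact Polynomial.leadingCoeff_ne_zero.2 hn)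
  · intro h n m hm
    have h1 := h n (S_coeff_ne hm)
    have h2 : (m : ℤ) ≤ (F.coeff n).natDegree := by exact_mod_cast Polynomial.le_natDegree_of_ne_zero hm
    linarith

lemma FF_iff {j d : ℕ} {F : S} : FF j F d ↔ ∀ n, F.coeff n ≠ 0 → (F.coeff n).natDegree ≤ d * j := by
  constructor
  · intro h n hn
    exact h n _ (by rw [Polynomial.coeff_natDegree]; exact Polynomial.leadingCoeff_ne_zero.2 hn)
  · intro h n m hm
    exact (Polynomial.le_natDegree_of_ne_zero hm).trans (h n (S_coeff_ne hm))

lemma swap_EE (hp : p.natDegree ≠ 0) {f : BpAlg p} {j : ℕ} (h : FF j (io p f) p.natDegree) :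
    EE j (io p (swapHom p f)) p.natDegree := by
  rw [EE_iff]; rw [FF_iff] at h
  intro n hn
  obtain ⟨h1, h2⟩ := swap_deg hp f n hn
  have h3 : ((((io p f).coeff (-n)).natDegree : ℕ) : ℤ) ≤ (p.natDegree * j : ℕ) := by exact_mod_cast h _ h1
  push_cast at h3
  linarith

lemma swap_FF (hp : p.natDegree ≠ 0) {f : BpAlg p} {i : ℕ} (h : EE i (io p f) p.natDegree) :
    FF i (io p (swapHom p f)) p.natDegree := by
  rw [FF_iff]; rw [EE_iff] at h
  intro n hn
  obtain ⟨h1, h2⟩ := swap_deg hp f n hn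
  have h3 := h _ h1
  zify
  linarith

lemma SL.comp {φ : BpAlg p ≃+* BpAlg p} (h : SL φ) (θ : BpAlg p ≃ₐ[ℂ] BpAlg p) :
    SL (φ.trans θ.toRingEquiv) := by
  intro c f
  show θ (φ (c • f)) = _ • θ (φ f)
  rw [h, map_smul]

end
end Dan

namespace Dan

section
variable {p : Polynomial ℂ}

lemma hom_id (hp : p ≠ 0) (f : BpAlg p →ₐ[ℂ] BpAlg p) (hx : f (bx p) = bx p) (hz : f (bz p) = bz p) :
    ∀ u, f u = u := by
  intro u
  refine bhom_ext p f (AlgHom.id ℂ _) (by simpa using hx) (x_cancel hp ?_) (by simpa using hz) u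
  have : f (bx p * by' p) = bx p * by' p := by
    rw [rel, ← Polynomial.aeval_algHom_apply, hz]
  rw [map_mul, hx] at this
  simpa using this

lemma exists_w (k : ℕ) (hk : 1 ≤ k) (c : ℂ) : ∃ w : BpAlg p,
    bx p * (by' p + w) = Polynomial.aeval (bz p + algebraMap ℂ _ c * bx p ^ k) p := by
  have h := Polynomial.sub_dvd_eval_sub (bz p + algebraMap ℂ _ c * bx p ^ k) (bz p)
    (p.map (algebraMap ℂ (BpAlg p)))
  rw [add_sub_cancel_left] at h
  obtain ⟨v, hv⟩ := h
  obtain ⟨l, rfl⟩ := Nat.exists_eq_add_of_le' hk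
  refine ⟨algebraMap ℂ _ c * bx p ^ l * v, ?_⟩
  simp only [Polynomial.eval_map_algebraMap] at hv
  rw [mul_add, rel]
  linear_combination -hv

noncomputable def shearHom (p : Polynomial ℂ) (k : ℕ) (hk : 1 ≤ k) (c : ℂ) : BpAlg p →ₐ[ℂ] BpAlg p :=
  blift (bx p) (by' p + (exists_w k hk c).choose) (bz p + algebraMap ℂ _ c * bx p ^ k)
    (exists_w k hk c).choose_spec

lemma shear_x (k : ℕ) (hk : 1 ≤ k) (c : ℂ) : shearHom p k hk c (bx p) = bx p := by simp [shearHom]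
lemma shear_z (k : ℕ) (hk : 1 ≤ k) (c : ℂ) :
    shearHom p k hk c (bz p) = bz p + algebraMap ℂ _ c * bx p ^ k := by simp [shearHom]

lemma shear_shear (hp : p ≠ 0) (k : ℕ) (hk : 1 ≤ k) (c c' : ℂ) (h : c + c' = 0) (u : BpAlg p) :
    shearHom p k hk c (shearHom p k hk c' u) = u := by
  refine hom_id hp ((shearHom p k hk c).comp (shearHom p k hk c')) ?_ ?_ u
  · simp [shear_x]
  · simp only [AlgHom.comp_apply, shear_z, map_add, map_mul, map_pow, shear_x, AlgHom.commutes]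
    rw [add_assoc, ← add_mul, ← map_add, h]; simp

noncomputable def shear (hp : p ≠ 0) (k : ℕ) (hk : 1 ≤ k) (c : ℂ) : BpAlg p ≃ₐ[ℂ] BpAlg p :=
  AlgEquiv.ofAlgHom (shearHom p k hk c) (shearHom p k hk (-c))
    (AlgHom.ext (shear_shear hp k hk c (-c) (by ring))) (AlgHom.ext (shear_shear hp k hk (-c) c (by ring)))

/-- translation of the coefficients -/
noncomputable def tau (c : ℂ) : S →+* S :=
  AddMonoidAlgebra.mapRingHom ℤ (Polynomial.compRingHom (Polynomial.X + Polynomial.C c))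

lemma tau_coeff (c : ℂ) (f : S) (n : ℤ) : (tau c f).coeff n = (f.coeff n).comp (Polynomial.X + Polynomial.C c) := by
  simp [tau]

lemma tau_mo (c : ℂ) (n : ℤ) (h : Polynomial ℂ) :
    tau c (mo n h) = mo n (h.comp (Polynomial.X + Polynomial.C c)) := by
  apply S_ext; intro k; rw [tau_coeff, mo_coeff, mo_coeff]; split_ifs <;> simp

lemma psi_shear (N : ℤ) (k : ℕ) (hk : 1 ≤ k) (c : ℂ) (f : BpAlg p) :
    psi N (N * k) (io p (shearHom p k hk c f)) = tau c (psi N (N * k) (io p f)) := by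
  have pc : ∀ c', psi N (N * k) (algebraMap ℂ S c') = algebraMap ℂ S c' := by
    intro c'
    have := psi_mono N (N * k) 0 0 c'
    simpa [algMap_eq] using this
  have tc : ∀ c', tau c (algebraMap ℂ S c') = algebraMap ℂ S c' := by
    intro c'; rw [algMap_eq, tau_mo]; simp
  let A : BpAlg p →ₐ[ℂ] S :=
    { (psi N (N * k)).comp ((io p).comp (shearHom p k hk c)).toRingHom with
      commutes' := fun c' => by
        show psi N (N * k) (io p (shearHom p k hk c (algebraMap ℂ _ c'))) = _
        rw [AlgHom.commutes, AlgHom.commutes, pc] }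
  let B : BpAlg p →ₐ[ℂ] S :=
    { (tau c).comp ((psi N (N * k)).comp (io p).toRingHom) with
      commutes' := fun c' => by
        show tau c (psi N (N * k) (io p (algebraMap ℂ _ c'))) = _
        rw [AlgHom.commutes, pc, tc] }
  have hA : ∀ u, A u = psi N (N * k) (io p (shearHom p k hk c u)) := fun _ => rfl
  have hB : ∀ u, B u = tau c (psi N (N * k) (io p u)) := fun _ => rfl
  have ex : A (bx p) = B (bx p) := by
    rw [hA, hB, shear_x, io_x, psi_x, tau_mo]; simp
  have ez : A (bz p) = B (bz p) := by
    have e := psi_mono N (N * k) 0 1 1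
    have e2 : (Polynomial.monomial 1 (1:ℂ)) = Polynomial.X := rfl
    rw [e2] at e
    rw [hA, hB, shear_z, map_add, map_mul, map_pow, AlgHom.commutes, io_z, io_x, map_add, map_mul, map_pow,
      psi_x, pc, mo_pow, e, tau_mo, algMap_eq, mo_mul]
    simp [mo_add]
    congr 1; ring
  refine bhom_ext p A B ex ?_ ez f
  have h1 : A (bx p) * A (by' p) = B (bx p) * B (by' p) := by
    rw [← map_mul, ← map_mul, rel, ← Polynomial.aeval_algHom_apply, ← Polynomial.aeval_algHom_apply, ez]
  have h2 : A (bx p) = mo N 1 := by rw [hA, shear_x, io_x, psi_x]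
  rw [← ex, h2] at h1
  have h3 := congrArg (fun u => mo (-N) 1 * u) h1
  simpa [← mul_assoc, mo_mul, mo_one] using h3

lemma single_root {P : Polynomial ℂ} {D : ℕ} (hD : P.natDegree = D) (hD0 : D ≠ 0)
    (h : ∀ (c : ℂ) (m : ℕ) (R : Polynomial ℂ), 1 ≤ m → P = (Polynomial.X - Polynomial.C c) ^ m * R →
      R.eval c ≠ 0 → D < 2 * m) :
    ∃ c a : ℂ, a ≠ 0 ∧ P = (Polynomial.X - Polynomial.C c) ^ D * Polynomial.C a := by
  have hP0 : P ≠ 0 := by rintro rfl; simp at hD; omega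
  obtain ⟨c, hc⟩ := Complex.exists_root (f := P) (by rw [Polynomial.degree_eq_natDegree hP0, hD]; exact_mod_cast Nat.pos_of_ne_zero hD0)
  have ex : ∀ c, P.IsRoot c → ∃ (m : ℕ) (R : Polynomial ℂ), 1 ≤ m ∧ P = (Polynomial.X - Polynomial.C c) ^ m * R ∧
      R.eval c ≠ 0 := by
    intro c hc
    obtain ⟨R, hR, hR'⟩ := Polynomial.exists_eq_pow_rootMultiplicity_mul_and_not_dvd P hP0 c
    refine ⟨_, R, (Polynomial.rootMultiplicity_pos hP0).2 hc, hR, ?_⟩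
    rwa [Polynomial.dvd_iff_isRoot] at hR'
  obtain ⟨m, R, hm, hR, hRc⟩ := ex c hc
  have hRne : R ≠ 0 := by rintro rfl; simp at hRc
  have hmD := h c m R hm hR hRc
  have hdeg : m + R.natDegree = D := by
    rw [← hD, hR, Polynomial.natDegree_mul (pow_ne_zero _ (Polynomial.X_sub_C_ne_zero c)) hRne]; simp
  by_cases hR0 : R.natDegree = 0
  · obtain ⟨a, ha⟩ := Polynomial.natDegree_eq_zero.1 hR0
    refine ⟨c, a, ?_, ?_⟩
    · rintro rfl; simp at ha; exact hRne ha.symm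
    · rw [ha, hR]; congr 2; omega
  · exfalso
    obtain ⟨c', hc'⟩ := Complex.exists_root (f := R) (by
      rw [Polynomial.degree_eq_natDegree hRne]; exact_mod_cast Nat.pos_of_ne_zero hR0)
    have hcc : c' ≠ c := by rintro rfl; exact hRc hc'
    obtain ⟨m', R', hm', hR', hRc'⟩ := ex c' (by rw [hR, Polynomial.IsRoot.def, Polynomial.eval_mul, hc'.eq_zero, mul_zero])
    have := h c' m' R' hm' hR' hRc'
    have hdv : (Polynomial.X - Polynomial.C c') ^ m' ∣ R := by
      have hco : IsCoprime ((Polynomial.X - Polynomial.C c') ^ m') ((Polynomial.X - Polynomial.C c) ^ m) :=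
        IsCoprime.pow (Polynomial.isCoprime_X_sub_C_of_isUnit_sub (sub_ne_zero.2 hcc).isUnit)
      exact hco.dvd_of_dvd_mul_left ⟨R', hR.symm.trans hR'⟩
    have := Polynomial.natDegree_le_of_dvd hdv hRne
    simp at this
    omega

end
end Dan

namespace Dan

section
variable {p : Polynomial ℂ}

lemma reduce (hp : p.natDegree ≠ 0) {φ : BpAlg p ≃+* BpAlg p} (h : SL φ) {i j : ℕ}
    (hE : EE i (io p (φ (bx p))) p.natDegree) (hF : FF j (io p (φ (bx p))) p.natDegree)
    (hi : ((io p (φ (bx p))).coeff i).coeff 0 ≠ 0)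
    (hj : ((io p (φ (bx p))).coeff (-j)).coeff (p.natDegree * j) ≠ 0) (hj1 : 1 ≤ j) (hij : j ≤ i) :
    ∃ (φ' : BpAlg p ≃+* BpAlg p) (i' j' : ℕ), SL φ' ∧ EE i' (io p (φ' (bx p))) p.natDegree ∧
      FF j' (io p (φ' (bx p))) p.natDegree ∧ i' + j' < i + j := by
  have hp0 := ne_zero_of hp
  set X := io p (φ (bx p)) with hX
  set d := p.natDegree with hd
  have hN : (0 : ℤ) < d * j := by positivity
  obtain ⟨n, m, hW, hc, hnm⟩ := face hp h (d * j) (i + j) hN (by positivity)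
  have hWeq : (d * j : ℤ) * n + (i + j) * m = d * j * i := by
    apply le_antisymm
    · have h1 := hE _ _ hc
      have h2 := hF _ _ hc
      rcases hnm with ⟨h3, rfl⟩ | ⟨h3, h4⟩
      · have : (d * j : ℤ) * n ≤ d * j * i := by
          push_cast at h1
          have : (j : ℤ) * (d * n + 0) ≤ j * (d * i) := mul_le_mul_of_nonneg_left h1 (by positivity)
          linarith
        simpa using this
      · have h2' : (m : ℤ) ≤ d * j := by exact_mod_cast h2
        have h5 : (i : ℤ) * m ≤ i * (d * j) := mul_le_mul_of_nonneg_left h2' (by positivity)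
        have h6 : (j : ℤ) * m = - d * n * j := by rw [h4]; ring
        linarith
    · have := psi_le hN.ne' hW hi
      simpa using this
  rw [hWeq] at hW
  set P := (psi (d * j) (i + j) X).coeff ((d : ℤ) * j * i) with hP
  have c0 : P.coeff 0 ≠ 0 := by
    have := psi_coeff (d * j) (i + j) hN.ne' X i 0
    rw [Nat.cast_zero, mul_zero, add_zero] at this
    rw [hP, this]; exact hi
  have cD : P.coeff (d * j) ≠ 0 := by
    have := psi_coeff (d * j) (i + j) hN.ne' X (-j) (d * j)
    have e : (d * j : ℤ) * (-j) + (i + j) * ((d * j : ℕ) : ℤ) = d * j * i := by push_cast; ring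
    rw [e] at this
    rw [hP, this]; exact hj
  have hP0 : P ≠ 0 := by intro h0; rw [h0] at c0; simp at c0
  have hdeg : P.natDegree = d * j := by
    apply le_antisymm _ (Polynomial.le_natDegree_of_ne_zero cD)
    have hl : P.coeff P.natDegree ≠ 0 := by
      rw [Polynomial.coeff_natDegree]; exact Polynomial.leadingCoeff_ne_zero.2 hP0
    obtain ⟨n', hn'⟩ := psi_coeff_ne _ _ _ _ _ hl
    have := psi_coeff (d * j) (i + j) hN.ne' X n' P.natDegree
    rw [← hn'] at this
    exact hF n' _ (by rw [← this]; exact hl)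
  have hD0 : d * j ≠ 0 := by positivity
  obtain ⟨c, a, ha, hPc⟩ := single_root hdeg hD0 (by
    intro c m R hm hR hRc
    obtain ⟨n1, h1⟩ := h.nil hp (bx p)
    rw [io_x] at h1
    obtain ⟨k, hk⟩ := nil_ord (d * j) (i + j) hN.ne' hW c m hm R hR hRc n1 (mo 1 1) (d * j) 0 1
      (by rw [psi_x]; intro k hk; rw [mo_coeff, if_neg (by omega)])
      (by rw [psi_x, mo_coeff, if_pos rfl]; simp) (by simp) h1
    have hm' : (0 : ℤ) < m := by exact_mod_cast hm
    have hneg : (k : ℤ) * (d * j * i - m * (i + j)) < 0 := by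
      rw [← hk]; push_cast
      have : (0 : ℤ) < d * j * m := mul_pos hN hm'
      linarith
    have h3 : (d * j * i : ℤ) < m * (i + j) := by
      by_contra hle
      have : (0 : ℤ) ≤ k * (d * j * i - m * (i + j)) := mul_nonneg (by positivity) (by linarith)
      linarith
    by_contra hle
    have h4 : (2 * m : ℤ) ≤ d * j := by exact_mod_cast not_lt.1 hle
    have hij' : (j : ℤ) ≤ i := by exact_mod_cast hij
    have h5 : (2 * m : ℤ) * i ≤ d * j * i := mul_le_mul_of_nonneg_right h4 (by positivity)
    have h6 : (m : ℤ) * j ≤ m * i := mul_le_mul_of_nonneg_left hij' (by positivity)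
    linarith)
  have hc0 : c ≠ 0 := by
    rintro rfl
    rw [hPc] at c0
    simp [Polynomial.coeff_zero_eq_eval_zero] at c0
    omega
  -- integrality of the exponent
  obtain ⟨k, hk1, hk⟩ : ∃ k : ℕ, 1 ≤ k ∧ (i + j : ℤ) = d * j * k := by
    have hcn : P.coeff (d * j - 1) ≠ 0 := by
      obtain ⟨D, hD⟩ := Nat.exists_eq_succ_of_ne_zero hD0
      rw [hPc, Polynomial.coeff_mul_C, hD, Nat.succ_eq_add_one, Nat.add_sub_cancel, sub_eq_add_neg,
        ← Polynomial.C_neg, Polynomial.coeff_X_add_C_pow]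
      refine mul_ne_zero (mul_ne_zero (pow_ne_zero _ (neg_ne_zero.2 hc0)) ?_) ha
      rw [Nat.choose_succ_self_right]; exact_mod_cast Nat.succ_ne_zero D
    obtain ⟨n', hn'⟩ := psi_coeff_ne _ _ _ _ _ hcn
    have e : ((d * j - 1 : ℕ) : ℤ) = d * j - 1 := by
      rw [Nat.cast_sub (by omega)]; push_cast; ring
    rw [e] at hn'
    have e2 : (i + j : ℤ) = d * j * (n' + j) := by linear_combination hn'
    have e3 : 0 < n' + j := by
      by_contra hle
      have := mul_nonpos_of_nonneg_of_nonpos hN.le (not_lt.1 hle)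
      omega
    refine ⟨(n' + j).toNat, by omega, ?_⟩
    rw [Int.toNat_of_nonneg e3.le]; exact e2
  rw [hk] at hW hP
  refine ⟨φ.trans (shear hp0 k hk1 c).toRingEquiv, ?_⟩
  have hSL := h.comp (shear hp0 k hk1 c)
  have hX' : ∀ u, io p ((φ.trans (shear hp0 k hk1 c).toRingEquiv) u) = io p (shearHom p k hk1 c (φ u)) :=
    fun _ => rfl
  obtain ⟨i', hE', hi'⟩ := faceE hp hSL
  obtain ⟨j', hF', hj'⟩ := faceF hp hSL
  refine ⟨i', j', hSL, hE', hF', ?_⟩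
  have hpsi := psi_shear (d * j) k hk1 c (φ (bx p))
  rw [← hX'] at hpsi
  rw [← hX] at hpsi
  set X' := io p ((φ.trans (shear hp0 k hk1 c).toRingEquiv) (bx p)) with hX''
  have hW' : Le (d * j * i) (psi (d * j) (d * j * k) X') := by
    intro l hl
    rw [hpsi, tau_coeff, hW l hl]; simp
  have hPt : (psi (d * j) (d * j * k) X').coeff (d * j * i) = Polynomial.X ^ (d * j) * Polynomial.C a := by
    rw [hpsi, tau_coeff, ← hP, hPc]
    simp
  have hi'' : i' < i := by
    rcases hi' with rfl | hi'
    · omega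
    · have h1 := psi_le hN.ne' hW' hi'
      have h2 : i' ≤ i := by
        have : (d * j : ℤ) * i' ≤ d * j * i := by simpa using h1
        exact_mod_cast le_of_mul_le_mul_left this hN
      refine lt_of_le_of_ne h2 ?_
      rintro rfl
      have := psi_coeff (d * j) (d * j * k) hN.ne' X' i' 0
      rw [Nat.cast_zero, mul_zero, add_zero, hPt] at this
      rw [← this] at hi'
      apply hi'
      rw [Polynomial.coeff_mul_C, Polynomial.coeff_X_pow, if_neg (by omega), zero_mul]
  have hj'' : j' ≤ j := by
    rcases hj' with rfl | hj'
    · omega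
    · have h1 := psi_le hN.ne' hW' hj'
      rw [← hk] at h1
      have h2 : (d * i : ℤ) * j' ≤ d * i * j := by push_cast at h1; linarith
      have h3 : (0 : ℤ) < d * i := by
        have : 0 < i := by omega
        positivity
      exact_mod_cast le_of_mul_le_mul_left h2 h3
  omega

lemma exists_straight_aux (hp : p.natDegree ≠ 0) (s : ℕ) : ∀ (φ : BpAlg p ≃+* BpAlg p) (i j : ℕ), SL φ →
    EE i (io p (φ (bx p))) p.natDegree → FF j (io p (φ (bx p))) p.natDegree → i + j ≤ s →
    ∃ φ' : BpAlg p ≃+* BpAlg p, SL φ' ∧ FF 0 (io p (φ' (bx p))) p.natDegree := by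
  induction s using Nat.strong_induction_on with
  | _ s ih =>
  have hd : 0 < p.natDegree := Nat.pos_of_ne_zero hp
  have sharp : ∀ (φ : BpAlg p ≃+* BpAlg p) (i j : ℕ), SL φ →
      EE i (io p (φ (bx p))) p.natDegree → FF j (io p (φ (bx p))) p.natDegree →
      (∃ i' j', i' ≤ i ∧ j' ≤ j ∧ EE i' (io p (φ (bx p))) p.natDegree ∧ FF j' (io p (φ (bx p))) p.natDegree ∧
        (i' = 0 ∨ ((io p (φ (bx p))).coeff i').coeff 0 ≠ 0) ∧
        (j' = 0 ∨ ((io p (φ (bx p))).coeff (-j')).coeff (p.natDegree * j') ≠ 0)) := by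
    intro φ i j h hE hF
    obtain ⟨i', hE', hi'⟩ := faceE hp h
    obtain ⟨j', hF', hj'⟩ := faceF hp h
    refine ⟨i', j', ?_, ?_, hE', hF', hi', hj'⟩
    · rcases hi' with rfl | hi'
      · omega
      · have := hE _ _ hi'
        push_cast at this
        rw [add_zero] at this
        exact_mod_cast le_of_mul_le_mul_left this (by exact_mod_cast hd)
    · rcases hj' with rfl | hj'
      · omega
      · exact le_of_mul_le_mul_left (hF _ _ hj') hd
  have good : ∀ (φ : BpAlg p ≃+* BpAlg p) (i j : ℕ), SL φ →
      EE i (io p (φ (bx p))) p.natDegree → FF j (io p (φ (bx p))) p.natDegree → i + j ≤ s →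
      (i = 0 ∨ ((io p (φ (bx p))).coeff i).coeff 0 ≠ 0) →
      (j = 0 ∨ ((io p (φ (bx p))).coeff (-j)).coeff (p.natDegree * j) ≠ 0) → j ≤ i →
      ∃ φ' : BpAlg p ≃+* BpAlg p, SL φ' ∧ FF 0 (io p (φ' (bx p))) p.natDegree := by
    intro φ i j h hE hF hs hi hj hij
    rcases Nat.eq_zero_or_pos j with rfl | hj0
    · exact ⟨φ, h, hF⟩
    · obtain ⟨φ', i', j', h', hE', hF', hlt⟩ := reduce hp h hE hF (hi.resolve_left (by omega))
        (hj.resolve_left (by omega)) hj0 hij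
      exact ih (i' + j') (by omega) φ' i' j' h' hE' hF' le_rfl
  intro φ i0 j0 h hE0 hF0 hs
  obtain ⟨i, j, hi0, hj0, hE, hF, hi, hj⟩ := sharp φ i0 j0 h hE0 hF0
  by_cases hij : j ≤ i
  · exact good φ i j h hE hF (by omega) hi hj hij
  · have h2 := h.comp (swap p)
    have hE2 : EE j (io p ((φ.trans (swap p).toRingEquiv) (bx p))) p.natDegree := swap_EE hp hF
    have hF2 : FF i (io p ((φ.trans (swap p).toRingEquiv) (bx p))) p.natDegree := swap_FF hp hE
    obtain ⟨i1, j1, hi1, hj1, hE1, hF1, hi1', hj1'⟩ := sharp _ j i h2 hE2 hF2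
    by_cases hij1 : j1 ≤ i1
    · exact good _ i1 j1 h2 hE1 hF1 (by omega) hi1' hj1' hij1
    · exact ih (i1 + j1) (by omega) _ i1 j1 h2 hE1 hF1 le_rfl

lemma exists_straight (hp : p.natDegree ≠ 0) {φ : BpAlg p ≃+* BpAlg p} (h : SL φ) :
    ∃ φ' : BpAlg p ≃+* BpAlg p, SL φ' ∧ FF 0 (io p (φ' (bx p))) p.natDegree := by
  obtain ⟨i, hE, -⟩ := faceE hp h
  obtain ⟨j, hF, -⟩ := faceF hp h
  exact exists_straight_aux hp (i + j) φ i j h hE hF le_rfl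

end
end Dan

namespace Dan

section
variable {p : Polynomial ℂ}

def Ge0 (f : S) : Prop := ∀ k, k < 0 → f.coeff k = 0

lemma Ge0.mul {f g : S} (hf : Ge0 f) (hg : Ge0 g) :
    Ge0 (f * g) ∧ (f * g).coeff 0 = f.coeff 0 * g.coeff 0 := by
  have ic : ∀ (f : S) n, (LaurentPolynomial.invert f).coeff n = f.coeff (-n) := by intro f n; simp
  have hf' : Le 0 (LaurentPolynomial.invert f) := fun k hk => by rw [ic]; exact hf _ (by omega)
  have hg' : Le 0 (LaurentPolynomial.invert g) := fun k hk => by rw [ic]; exact hg _ (by omega)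
  obtain ⟨h1, h2⟩ := hf'.mul hg'
  rw [← map_mul] at h1 h2
  constructor
  · intro k hk
    have := h1 (-k) (by omega)
    rwa [ic, neg_neg] at this
  · rw [add_zero, ic, ic, ic, neg_zero] at h2
    exact h2

lemma Ge0.aeval {Z : S} (hZ : Ge0 Z) (q : Polynomial ℂ) :
    Ge0 (Polynomial.aeval Z q) ∧ (Polynomial.aeval Z q).coeff 0 = q.comp (Z.coeff 0) := by
  induction q using Polynomial.induction_on with
  | C a =>
    rw [Polynomial.aeval_C, algMap_eq]
    refine ⟨fun k hk => by rw [mo_coeff, if_neg (by omega)], by rw [mo_coeff, if_pos rfl]; simp⟩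
  | add a b ha hb =>
    rw [map_add]
    exact ⟨fun k hk => by rw [coeff_add', ha.1 k hk, hb.1 k hk, add_zero], by
      rw [coeff_add', ha.2, hb.2, Polynomial.add_comp]⟩
  | monomial n a ih =>
    rw [pow_succ, ← mul_assoc]
    generalize Polynomial.C a * Polynomial.X ^ n = q at ih ⊢
    rw [map_mul, Polynomial.aeval_X, Polynomial.mul_comp, Polynomial.X_comp, ← ih.2]
    exact ih.1.mul hZ

lemma SL.poly {φ : BpAlg p ≃+* BpAlg p} (h : SL φ) (u : BpAlg p) (q : Polynomial ℂ) :
    φ (Polynomial.aeval u q) = Polynomial.aeval (φ u) (q.map (starRingEnd ℂ)) := by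
  induction q using Polynomial.induction_on' with
  | add a b ha hb => rw [map_add, map_add, ha, hb, Polynomial.map_add, map_add]
  | monomial n a => 
    rw [Polynomial.aeval_monomial, Polynomial.map_monomial, Polynomial.aeval_monomial, map_mul, map_pow, h.alg]

lemma affine_rel (hp : 2 ≤ p.natDegree) {φ : BpAlg p ≃+* BpAlg p} (h : SL φ)
    (hF : FF 0 (io p (φ (bx p))) p.natDegree) : ∃ ε β κ : ℂ, ε ≠ 0 ∧ κ ≠ 0 ∧
    (p.map (starRingEnd ℂ)).comp (Polynomial.C ε * Polynomial.X + Polynomial.C β) = Polynomial.C κ * p := by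
  have hp' : p.natDegree ≠ 0 := by omega
  have hp0 := ne_zero_of hp'
  obtain ⟨μ, hμ0, hμ⟩ := h.mu hp'
  set X := io p (φ (bx p)) with hX
  set Y := io p (φ (by' p)) with hY
  set Z := io p (φ (bz p)) with hZ
  have hdiv : ∀ (f : BpAlg p) (n : ℤ), n < 0 → ((io p f).coeff n).natDegree ≤ 1 → (io p f).coeff n = 0 := by
    intro f n hn hd
    by_contra h0
    have := cone hp' f n h0
    have h1 : (p.natDegree : ℤ) * n ≤ p.natDegree * (-1) := mul_le_mul_of_nonneg_left (by omega) (by positivity)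
    omega
  have hXdeg : ∀ n, (X.coeff n).natDegree = 0 := by
    intro n
    by_cases h0 : X.coeff n = 0
    · rw [h0]; simp
    · simpa using FF_iff.1 hF n h0
  have hXge : Ge0 X := fun n hn => hdiv _ n hn (by rw [← hX, hXdeg]; omega)
  have hX0 : X ≠ 0 := by
    rw [hX, ← map_zero (io p)]
    intro h0
    have := io_inj hp0 h0
    rw [← map_zero φ] at this
    have h2 := congrArg (fun u => (io p u).coeff 1) (φ.injective this)
    simp [mo_coeff] at h2
  have hdzX : dz X = 0 := by
    apply S_ext; intro n; rw [dz_coeff]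
    rw [Polynomial.eq_C_of_natDegree_eq_zero (hXdeg n)]; simp
  have hbr : th X * dz Z = algebraMap ℂ S μ * X := by
    have := congrArg (io p) (hμ (bx p) (bz p))
    rw [bb_xz hp0, io_bb, map_mul, AlgHom.commutes, ← hX, ← hZ, br, hdzX] at this
    simpa using this
  have hμS : algebraMap ℂ S μ ≠ 0 := by
    rw [algMap_eq]; intro h0
    have := congrArg (fun u : S => u.coeff 0) h0
    simp [mo_coeff, hμ0] at this
  have hthX : th X ≠ 0 := by
    intro h0; rw [h0, zero_mul] at hbr
    exact mul_ne_zero hμS hX0 hbr.symm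
  have hdzZ0 : dz Z ≠ 0 := by
    intro h0; rw [h0, mul_zero] at hbr
    exact mul_ne_zero hμS hX0 hbr.symm
  have hdd : dz (dz Z) = 0 := by
    have := congrArg dz hbr
    have hthdz : dz (th X) = 0 := by
      apply S_ext; intro n; rw [dz_coeff, th_coeff]
      rw [Polynomial.eq_C_of_natDegree_eq_zero (hXdeg n), ← Polynomial.C_eq_intCast, ← Polynomial.C_mul]; simp
    rw [dz_mul, dz_mul, hthdz, hdzX, algMap_eq, dz_mo, Polynomial.derivative_C, mo_zero] at this
    simp only [zero_mul, mul_zero, add_zero, zero_add] at this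
    exact (mul_eq_zero.1 this).resolve_left hthX
  have hZdeg : ∀ n, (Z.coeff n).natDegree ≤ 1 := by
    intro n
    have := congrArg (fun u : S => u.coeff n) hdd
    simp only [dz_coeff] at this
    have h1 : Polynomial.derivative (Polynomial.derivative (Z.coeff n)) = 0 := this
    have h2 := Polynomial.derivative_eq_zero.1 h1
    rw [Polynomial.natDegree_derivative] at h2
    omega
  have hZge : Ge0 Z := fun n hn => hdiv _ n hn (hZdeg n)
  have hle : Le 0 (dz Z) := by
    obtain ⟨n, hn, hn0⟩ := exists_top hX0
    obtain ⟨b, hb, hb0⟩ := exists_top hdzZ0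
    have hthle : Le n (th X) := fun k hk => by rw [th_coeff, hn k hk, mul_zero]
    have hnne : n ≠ 0 := by
      rintro rfl
      apply hthX
      apply S_ext; intro k; rw [th_coeff]
      rcases lt_trichotomy k 0 with hk | rfl | hk
      · rw [hXge k hk, mul_zero]; rfl
      · simp
      · rw [hn k hk, mul_zero]; rfl
    have hb' : b ≤ 0 := by
      by_contra hlt
      have h1 := (hthle.mul hb).2
      rw [hbr, algMap_eq, coeff_mo_mul, hn _ (by omega), mul_zero, th_coeff] at h1
      exact mul_ne_zero (mul_ne_zero (by exact_mod_cast hnne) hn0) hb0 h1.symm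
    intro k hk; exact hb k (by omega)
  obtain ⟨ε, hε⟩ : ∃ ε, (dz Z).coeff 0 = Polynomial.C ε := by
    refine ⟨_, Polynomial.eq_C_of_natDegree_eq_zero ?_⟩
    rw [dz_coeff, Polynomial.natDegree_derivative]
    have := hZdeg 0
    omega
  have hdzZ : dz Z = mo 0 (Polynomial.C ε) := by
    apply S_ext; intro k; rw [mo_coeff]
    split_ifs with hk
    · rw [← hk, hε]
    · rcases lt_or_gt_of_ne hk with hk | hk
      · exact hle k hk
      · rw [dz_coeff, hZge k hk]; simp
  have hε0 : ε ≠ 0 := by rintro rfl; rw [Polynomial.C_0, mo_zero] at hdzZ; exact hdzZ0 hdzZ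
  have hcoef : ∀ k : ℤ, X.coeff k ≠ 0 → (k : ℂ) * ε = μ := by
    intro k hk
    have := congrArg (fun u : S => u.coeff k) hbr
    simp only [hdzZ] at this
    rw [mul_comm, algMap_eq, coeff_mo_mul, coeff_mo_mul, sub_zero, th_coeff, ← mul_assoc] at this
    have := mul_right_cancel₀ hk this
    rw [← Polynomial.C_eq_intCast, ← Polynomial.C_mul] at this
    rw [mul_comm]; exact Polynomial.C_injective this
  obtain ⟨n, -, hn0⟩ := exists_top hX0
  have hXmo : X = mo n (X.coeff n) := by
    apply S_ext; intro k; rw [mo_coeff]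
    split_ifs with hk
    · rw [hk]
    · by_contra h0
      have := (hcoef k h0).trans (hcoef n hn0).symm
      have := mul_right_cancel₀ hε0 this
      exact hk (by exact_mod_cast this.symm)
  have hn1 : 0 < n := by
    have h1 : 0 ≤ n := by by_contra hlt; exact hn0 (hXge n (by omega))
    have h2 : n ≠ 0 := by rintro rfl; have := hcoef 0 hn0; simp at this; exact hμ0 this.symm
    omega
  have hZ0 : Z.coeff 0 = Polynomial.C ε * Polynomial.X + Polynomial.C ((Z.coeff 0).coeff 0) := by
    have h1 := Polynomial.eq_X_add_C_of_natDegree_le_one (hZdeg 0)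
    have h2 := congrArg (fun u => u.coeff 0) hε
    simp only [dz_coeff, Polynomial.coeff_derivative, Polynomial.coeff_C_zero] at h2
    have h3 : (Z.coeff 0).coeff 1 = ε := by simpa using h2
    rw [h3] at h1; exact h1
  refine ⟨ε, (Z.coeff 0).coeff 0, ?_⟩
  have hXY : X * Y = Polynomial.aeval Z (p.map (starRingEnd ℂ)) := by
    rw [hX, hY, ← map_mul, ← map_mul, rel, h.poly, ← Polynomial.aeval_algHom_apply]
  have hc0 := congrArg (fun u : S => u.coeff 0) hXY
  rw [hXmo, coeff_mo_mul, (hZge.aeval _).2, hZ0] at hc0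
  obtain ⟨N, rfl⟩ := Int.eq_ofNat_of_zero_le hn1.le
  have hdvd : p ∣ (p.map (starRingEnd ℂ)).comp (Polynomial.C ε * Polynomial.X + Polynomial.C ((Z.coeff 0).coeff 0)) := by
    rw [← hc0]
    apply Dvd.dvd.mul_left
    have := io_dvd p (φ (by' p)) N
    rw [zero_sub]
    exact (dvd_pow_self p (by omega)).trans this
  obtain ⟨r, hr⟩ := hdvd
  have hdeg : ((p.map (starRingEnd ℂ)).comp (Polynomial.C ε * Polynomial.X + Polynomial.C ((Z.coeff 0).coeff 0))).natDegree = p.natDegree := by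
    rw [Polynomial.natDegree_comp, Polynomial.natDegree_map, Polynomial.natDegree_linear hε0, mul_one]
  have hr0 : r ≠ 0 := by
    rintro rfl
    rw [hr, mul_zero] at hdeg; simp at hdeg; omega
  have hrd : r.natDegree = 0 := by
    rw [hr, Polynomial.natDegree_mul hp0 hr0] at hdeg; omega
  obtain ⟨κ, rfl⟩ := Polynomial.natDegree_eq_zero.1 hrd
  refine ⟨κ, hε0, ?_, by rw [hr, mul_comm]⟩
  rintro rfl; simp at hr0

end
end Dan

namespace Dan

section
variable {p : Polynomial ℂ}

lemma coeff_trans {f : Polynomial ℂ} {d : ℕ} (hd : f.natDegree = d + 1) (s : ℂ) :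
    (f.comp (Polynomial.X + Polynomial.C s)).coeff d = f.coeff d + (d + 1) * f.coeff (d + 1) * s := by
  rw [← Polynomial.taylor_apply, Polynomial.taylor_coeff]
  have h1 : (Polynomial.hasseDeriv d f).natDegree ≤ 1 := by
    have := Polynomial.natDegree_hasseDeriv_le f d; omega
  rw [Polynomial.eq_X_add_C_of_natDegree_le_one h1]
  simp [Polynomial.hasseDeriv_coeff, add_comm 1 d]
  ring

lemma real_lift {f : Polynomial ℂ} (h : ∀ i, (starRingEnd ℂ) (f.coeff i) = f.coeff i) :
    ∃ q : Polynomial ℝ, f = q.map (algebraMap ℝ ℂ) := by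
  have : f ∈ Polynomial.lifts (algebraMap ℝ ℂ) := by
    rw [Polynomial.lifts_iff_coeff_lifts]
    intro i
    exact ⟨(f.coeff i).re, Complex.conj_eq_iff_re.1 (h i)⟩
  obtain ⟨q, hq⟩ := this
  exact ⟨q, hq.symm⟩

lemma of_affine (hp : p.natDegree ≠ 0) {ε β κ : ℂ} (hε : ε ≠ 0) (hκ : κ ≠ 0)
    (h : (p.map (starRingEnd ℂ)).comp (Polynomial.C ε * Polynomial.X + Polynomial.C β) = Polynomial.C κ * p) :
    ∃ (a lam b : ℂ), a ≠ 0 ∧ lam ≠ 0 ∧ ∃ q : Polynomial ℝ,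
      Polynomial.C lam * p.comp (Polynomial.C a * Polynomial.X + Polynomial.C b) = q.map (algebraMap ℝ ℂ) := by
  have hp0 : p ≠ 0 := by rintro rfl; simp at hp
  obtain ⟨d, hd⟩ := Nat.exists_eq_succ_of_ne_zero hp
  rw [Nat.succ_eq_add_one] at hd
  have hlc : p.coeff (d + 1) ≠ 0 := by rw [← hd]; simpa using hp0
  have hd1 : (d + 1 : ℂ) ≠ 0 := by exact_mod_cast Nat.succ_ne_zero d
  set t : ℂ := - p.coeff d / ((d + 1) * p.coeff (d + 1)) with ht
  set q := p.comp (Polynomial.X + Polynomial.C t) with hq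
  have hqd : q.natDegree = d + 1 := by rw [hq, Polynomial.natDegree_comp, Polynomial.natDegree_X_add_C, mul_one, hd]
  have hq0 : q ≠ 0 := by intro h0; rw [h0] at hqd; simp at hqd
  have hqlc : q.coeff (d + 1) ≠ 0 := by rw [← hqd]; simpa using hq0
  have hqc : q.coeff d = 0 := by
    rw [hq, coeff_trans hd, ht]; field_simp; ring
  set β' : ℂ := β + ε * t - (starRingEnd ℂ) t with hβ'
  have hrel : (q.map (starRingEnd ℂ)).comp (Polynomial.C ε * Polynomial.X + Polynomial.C β') = Polynomial.C κ * q := by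
    have h1 := congrArg (fun u => Polynomial.comp u (Polynomial.X + Polynomial.C t)) h
    simp only [Polynomial.comp_assoc, Polynomial.mul_comp, Polynomial.C_comp, ← hq] at h1
    rw [← h1, hq, Polynomial.map_comp, Polynomial.comp_assoc]
    congr 1
    simp [hβ', mul_add]
    ring
  have hβ0 : β' = 0 := by
    have h1 : (q.map (starRingEnd ℂ)).comp (Polynomial.C ε * Polynomial.X + Polynomial.C β') =
        ((q.map (starRingEnd ℂ)).comp (Polynomial.X + Polynomial.C β')).comp (Polynomial.C ε * Polynomial.X) := by
      rw [Polynomial.comp_assoc]; simp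
    have h2 := congrArg (fun u => u.coeff d) hrel
    simp only [h1, Polynomial.comp_C_mul_X_coeff, Polynomial.coeff_C_mul, hqc, mul_zero] at h2
    rw [coeff_trans (by rw [Polynomial.natDegree_map, hqd])] at h2
    simp only [Polynomial.coeff_map, hqc, map_zero, zero_add, mul_eq_zero, pow_eq_zero_iff', hε, false_and, or_false] at h2
    rcases h2 with (h2 | h2) | h2
    · exact absurd h2 hd1
    · exact absurd ((map_eq_zero _).1 h2) hqlc
    · exact h2
  have hco : ∀ i, (starRingEnd ℂ) (q.coeff i) * ε ^ i = κ * q.coeff i := by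
    intro i
    have h2 := congrArg (fun u => u.coeff i) hrel
    simpa [hβ0, Polynomial.comp_C_mul_X_coeff] using h2
  suffices ∃ a lam : ℂ, a ≠ 0 ∧ lam ≠ 0 ∧ ∀ i, (starRingEnd ℂ) (lam * (q.coeff i * a ^ i)) = lam * (q.coeff i * a ^ i) by
    obtain ⟨a, lam, ha, hl, hr⟩ := this
    refine ⟨a, lam, t, ha, hl, real_lift ?_⟩
    have h1 : p.comp (Polynomial.C a * Polynomial.X + Polynomial.C t) = q.comp (Polynomial.C a * Polynomial.X) := by
      rw [hq, Polynomial.comp_assoc]; simp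
    intro i
    rw [h1, Polynomial.coeff_C_mul, Polynomial.comp_C_mul_X_coeff]
    exact hr i
  by_cases hex : ∃ i, i ≠ d + 1 ∧ q.coeff i ≠ 0
  · obtain ⟨i, hi, hqi⟩ := hex
    have hnorm : ∀ i, q.coeff i ≠ 0 → ‖ε‖ ^ i = ‖κ‖ := by
      intro i hi
      have := congrArg norm (hco i)
      rw [norm_mul, norm_mul, norm_pow, RCLike.norm_conj, mul_comm] at this
      exact mul_right_cancel₀ (norm_ne_zero_iff.2 hi) this
    have hε1 : ‖ε‖ = 1 := by
      have h1 := (hnorm i hqi).trans (hnorm _ hqlc).symm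
      by_contra hne
      exact hi (pow_right_injective₀ (norm_pos_iff.2 hε) hne h1)
    have hκ1 : ‖κ‖ = 1 := by rw [← hnorm i hqi, hε1, one_pow]
    obtain ⟨a, ha⟩ := IsAlgClosed.exists_pow_nat_eq (ε⁻¹) (n := 2) (by norm_num)
    obtain ⟨l, hl⟩ := IsAlgClosed.exists_pow_nat_eq κ (n := 2) (by norm_num)
    have hn : ∀ w : ℂ, ‖w ^ 2‖ = 1 → w * (starRingEnd ℂ) w = 1 := by
      intro w hw
      rw [norm_pow] at hw
      rw [Complex.mul_conj', ← Complex.ofReal_pow, hw, Complex.ofReal_one]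
    have ha1 := hn a (by rw [ha, norm_inv, hε1, inv_one])
    have hl1 := hn l (by rw [hl, hκ1])
    have ha0 : a ≠ 0 := left_ne_zero_of_mul_eq_one ha1
    have hl0 : l ≠ 0 := left_ne_zero_of_mul_eq_one hl1
    have haε : (starRingEnd ℂ) a = a * ε := by
      have : a ^ 2 * ε = 1 := by rw [ha, inv_mul_cancel₀ hε]
      apply mul_left_cancel₀ ha0
      rw [ha1, ← this]; ring
    have hlκ : (starRingEnd ℂ) l * κ = l := by
      rw [← hl]; linear_combination l * hl1
    refine ⟨a, l, ha0, hl0, fun i => ?_⟩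
    rw [map_mul, map_mul, map_pow, haε, mul_pow]
    calc _ = (starRingEnd ℂ) l * ((starRingEnd ℂ) (q.coeff i) * ε ^ i) * a ^ i := by ring
      _ = ((starRingEnd ℂ) l * κ) * (q.coeff i * a ^ i) := by rw [hco]; ring
      _ = _ := by rw [hlκ]
  · push Not at hex
    refine ⟨1, (q.coeff (d + 1))⁻¹, one_ne_zero, inv_ne_zero hqlc, fun i => ?_⟩
    by_cases hi : i = d + 1
    · subst hi; simp [hqlc]
    · simp [hex i hi]

/-- affine changes of coordinates -/
lemma affine_iso {a lam b : ℂ} (ha : a ≠ 0) (hl : lam ≠ 0) :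
    Nonempty (BpAlg p ≃ₐ[ℂ] BpAlg (Polynomial.C lam * p.comp (Polynomial.C a * Polynomial.X + Polynomial.C b))) := by
  obtain ⟨r, hr⟩ : ∃ r, r = Polynomial.C lam * p.comp (Polynomial.C a * Polynomial.X + Polynomial.C b) := ⟨_, rfl⟩
  rw [← hr]
  have hF : (algebraMap ℂ _ lam⁻¹ * bx r) * by' r = Polynomial.aeval (algebraMap ℂ _ a * bz r + algebraMap ℂ _ b) p := by
    have e : Polynomial.aeval (bz r) r = Polynomial.aeval (bz r)
        (Polynomial.C lam * p.comp (Polynomial.C a * Polynomial.X + Polynomial.C b)) :=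
      congrArg (Polynomial.aeval (bz r)) hr
    rw [mul_assoc, rel, e, map_mul, Polynomial.aeval_C, Polynomial.aeval_comp, ← mul_assoc, ← map_mul, inv_mul_cancel₀ hl]
    simp
  have hG : (algebraMap ℂ _ lam * bx p) * by' p = Polynomial.aeval (algebraMap ℂ _ a⁻¹ * (bz p - algebraMap ℂ _ b)) r := by
    rw [mul_assoc, rel, hr, map_mul, Polynomial.aeval_C, Polynomial.aeval_comp]
    congr 2
    simp only [map_add, map_mul, Polynomial.aeval_C, Polynomial.aeval_X]
    rw [← mul_assoc, ← map_mul, mul_inv_cancel₀ ha]; simp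
  refine ⟨AlgEquiv.ofAlgHom (blift _ _ _ hF) (blift _ _ _ hG) ?_ ?_⟩
  · refine AlgHom.ext fun u => bhom_ext r _ (AlgHom.id ℂ _) ?_ ?_ ?_ u
    · simp only [AlgHom.comp_apply, blift_x, map_mul, AlgHom.commutes, AlgHom.id_apply]
      rw [← mul_assoc, ← map_mul, mul_inv_cancel₀ hl]; simp
    · simp
    · simp only [AlgHom.comp_apply, blift_z, map_mul, map_sub, AlgHom.commutes, AlgHom.id_apply, add_sub_cancel_right]
      rw [← mul_assoc, ← map_mul, inv_mul_cancel₀ ha]; simp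
  · refine AlgHom.ext fun u => bhom_ext p _ (AlgHom.id ℂ _) ?_ ?_ ?_ u
    · simp only [AlgHom.comp_apply, blift_x, map_mul, AlgHom.commutes, AlgHom.id_apply]
      rw [← mul_assoc, ← map_mul, inv_mul_cancel₀ hl]; simp
    · simp
    · simp only [AlgHom.comp_apply, blift_z, map_mul, map_add, AlgHom.commutes, AlgHom.id_apply]
      rw [← mul_assoc, ← map_mul, mul_inv_cancel₀ ha]; simp

lemma real_conj (r : Polynomial ℂ) (hr : r.map (starRingEnd ℂ) = r) : ∃ σ : BpAlg r ≃+* BpAlg r,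
    (∀ f, σ (σ f) = f) ∧ ∀ (c : ℂ) (f : BpAlg r), σ (c • f) = (starRingEnd ℂ) c • σ f := by
  let G : MvPolynomial (Fin 3) ℂ →+* BpAlg r :=
    MvPolynomial.eval₂Hom ((algebraMap ℂ (BpAlg r)).comp (starRingEnd ℂ)) ![bx r, by' r, bz r]
  have hpoly : ∀ q : Polynomial ℂ, G (Polynomial.aeval (X 2) q) = Polynomial.aeval (bz r) (q.map (starRingEnd ℂ)) := by
    intro q
    induction q using Polynomial.induction_on' with
    | add a b ha hb => rw [map_add, map_add, ha, hb, Polynomial.map_add, map_add]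
    | monomial n a =>
      rw [Polynomial.aeval_monomial, Polynomial.map_monomial, Polynomial.aeval_monomial, map_mul, map_pow]
      simp [G, MvPolynomial.algebraMap_eq]
  let F : BpAlg r →+* BpAlg r := Ideal.Quotient.lift _ G (by
    intro a ha
    have hle : Ideal.span {(X 0 * X 1 : MvPolynomial (Fin 3) ℂ) - Polynomial.aeval (X 2) r} ≤ RingHom.ker G := by
      rw [Ideal.span_le, Set.singleton_subset_iff, SetLike.mem_coe, RingHom.mem_ker, map_sub, hpoly, hr, ← rel]
      simp [G]
    exact hle ha)
  have Fx : F (bx r) = bx r := by simp [F, G, bx]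
  have Fy : F (by' r) = by' r := by simp [F, G, by']
  have Fz : F (bz r) = bz r := by simp [F, G, bz]
  have Fc : ∀ c : ℂ, F (algebraMap ℂ _ c) = algebraMap ℂ _ ((starRingEnd ℂ) c) := by
    intro c
    show G (MvPolynomial.C c) = _
    simp [G]
  have FF : ∀ f, F (F f) = f := by
    intro f
    refine gen_ind r (P := fun f => F (F f) = f) f ?_ ?_ ?_ ?_ ?_
    · intro c; rw [Fc, Fc, Complex.conj_conj]
    · intro a b ha hb; rw [map_add, map_add, ha, hb]
    · intro a ha; rw [map_mul, map_mul, ha, Fx, Fx]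
    · intro a ha; rw [map_mul, map_mul, ha, Fy, Fy]
    · intro a ha; rw [map_mul, map_mul, ha, Fz, Fz]
  refine ⟨RingEquiv.ofRingHom F F (RingHom.ext FF) (RingHom.ext FF), FF, ?_⟩
  intro c f
  show F (c • f) = _ • F f
  have e1 : c • f = algebraMap ℂ (BpAlg r) c * f := Algebra.smul_def c f
  have e2 : (starRingEnd ℂ) c • F f = algebraMap ℂ (BpAlg r) ((starRingEnd ℂ) c) * F f :=
    Algebra.smul_def ((starRingEnd ℂ) c) (F f)
  rw [e1, e2, map_mul, Fc]

end
end Dan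

/-- Existence criterion for real structures on the surfaces `D_p` (`xy = p(z)`):
having a real structure is equivalent to `λ·p(az+b)` having real coefficients for some
`a, λ ∈ ℂ*`, `b ∈ ℂ`, and also to `D_p` being isomorphic to some `D_q` with `q ∈ ℝ[z]`. -/
theorem existence_real_structure_Danielewski (p : Polynomial ℂ) (hp : p.natDegree ≠ 0) :
    ((∃ σ : BpAlg p ≃+* BpAlg p,
        (∀ f : BpAlg p, σ (σ f) = f) ∧
        (∀ (c : ℂ) (f : BpAlg p), σ (c • f) = (starRingEnd ℂ) c • σ f)) ↔
      (∃ (a lam b : ℂ), a ≠ 0 ∧ lam ≠ 0 ∧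
        ∃ q : Polynomial ℝ,
          Polynomial.C lam * p.comp (Polynomial.C a * Polynomial.X + Polynomial.C b)
            = q.map (algebraMap ℝ ℂ))) ∧
    ((∃ (a lam b : ℂ), a ≠ 0 ∧ lam ≠ 0 ∧
        ∃ q : Polynomial ℝ,
          Polynomial.C lam * p.comp (Polynomial.C a * Polynomial.X + Polynomial.C b)
            = q.map (algebraMap ℝ ℂ)) ↔
      (∃ q : Polynomial ℝ, Nonempty (BpAlg p ≃ₐ[ℂ] BpAlg (q.map (algebraMap ℝ ℂ))))) := by
  have h12 : (∃ σ : BpAlg p ≃+* BpAlg p,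
        (∀ f : BpAlg p, σ (σ f) = f) ∧
        (∀ (c : ℂ) (f : BpAlg p), σ (c • f) = (starRingEnd ℂ) c • σ f)) →
      (∃ (a lam b : ℂ), a ≠ 0 ∧ lam ≠ 0 ∧
        ∃ q : Polynomial ℝ,
          Polynomial.C lam * p.comp (Polynomial.C a * Polynomial.X + Polynomial.C b)
            = q.map (algebraMap ℝ ℂ)) := by
    rintro ⟨σ, -, hσ⟩
    by_cases hd : p.natDegree = 1
    · have h1 := Polynomial.eq_X_add_C_of_natDegree_le_one hd.le
      have hl : p.coeff 1 ≠ 0 := by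
        have : p ≠ 0 := by rintro rfl; simp at hp
        rw [← hd]; simpa using this
      refine ⟨(p.coeff 1)⁻¹, 1, -(p.coeff 0) / p.coeff 1, inv_ne_zero hl, one_ne_zero, Polynomial.X, ?_⟩
      generalize p.coeff 1 = u at *
      generalize p.coeff 0 = v at *
      subst h1
      simp only [Polynomial.add_comp, Polynomial.mul_comp, Polynomial.C_comp, Polynomial.X_comp, Polynomial.map_X,
        Polynomial.C_1, one_mul, mul_add, ← mul_assoc, ← Polynomial.C_mul]
      rw [mul_inv_cancel₀ hl, mul_div_cancel₀ _ hl]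
      simp
    · obtain ⟨φ, hφ, hF⟩ := Dan.exists_straight hp (φ := σ) hσ
      obtain ⟨ε, β, κ, hε, hκ, h⟩ := Dan.affine_rel (by omega) hφ hF
      exact Dan.of_affine hp hε hκ h
  have h23 : (∃ (a lam b : ℂ), a ≠ 0 ∧ lam ≠ 0 ∧
        ∃ q : Polynomial ℝ,
          Polynomial.C lam * p.comp (Polynomial.C a * Polynomial.X + Polynomial.C b)
            = q.map (algebraMap ℝ ℂ)) →
      (∃ q : Polynomial ℝ, Nonempty (BpAlg p ≃ₐ[ℂ] BpAlg (q.map (algebraMap ℝ ℂ)))) := by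
    rintro ⟨a, lam, b, ha, hl, q, hq⟩
    exact ⟨q, hq ▸ Dan.affine_iso ha hl⟩
  have h31 : (∃ q : Polynomial ℝ, Nonempty (BpAlg p ≃ₐ[ℂ] BpAlg (q.map (algebraMap ℝ ℂ)))) →
      (∃ σ : BpAlg p ≃+* BpAlg p,
        (∀ f : BpAlg p, σ (σ f) = f) ∧
        (∀ (c : ℂ) (f : BpAlg p), σ (c • f) = (starRingEnd ℂ) c • σ f)) := by
    rintro ⟨q, ⟨e⟩⟩
    obtain ⟨σ, h1, h2⟩ := Dan.real_conj (q.map (algebraMap ℝ ℂ)) (by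
      rw [Polynomial.map_map]; congr 1; ext; simp)
    refine ⟨(e.toRingEquiv.trans σ).trans e.symm.toRingEquiv, ?_, ?_⟩
    · intro f
      show e.symm (σ (e (e.symm (σ (e f))))) = f
      rw [AlgEquiv.apply_symm_apply, h1, AlgEquiv.symm_apply_apply]
    · intro c f
      show e.symm (σ (e (c • f))) = _ • e.symm (σ (e f))
      rw [map_smul, h2, map_smul]
  exact ⟨⟨h12, fun h => h31 (h23 h)⟩, ⟨h23, fun h => h12 (h31 h)⟩⟩
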